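/- arXiv:1907.12724 — 3 statements merged into one kernel-verified Lean document; each statement's English description precedes it below -/
import Mathlib

section
/- Let n ≥ 1, let q be a polynomial with real coefficients of degree at most 2n, and let 0 ≤ a < b. Then max over z ∈ [a,b] of |q(z)| is at least |q(0)| / T_{2n}((a+b)/(b−a)), where T_{2n} is the Chebyshev polynomial of the first kind of degree 2n. -/
open MeasureTheory ProbabilityTheory Filter
open scoped BigOperators

noncomputable section

/-- A real polynomial of degree at most `n` bounded by `M` in absolute value on `[-1, 1]` is bounded
by `M * T_n` in absolute value on `[1, ∞)`. -/
theorem Polynomial.abs_eval_le_mul_eval_chebyshev_T {n : ℕ} {P : Polynomial ℝ} {M x : ℝ}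
    (hM : 0 < M) (hx : 1 ≤ x) (hdeg : P.natDegree ≤ n)
    (hbnd : ∀ y ∈ Set.Icc (-1) 1, |P.eval y| ≤ M) :
    |P.eval x| ≤ M * (Chebyshev.T ℝ n).eval x := by
  have key (s : ℝ) (hs : |s| = 1) : s * P.eval x ≤ M * (Chebyshev.T ℝ n).eval x := by
    have h := Chebyshev.eval_iterate_derivative_le_of_forall_abs_le_one (n := n)
      (P := C (s / M) * P) (k := 0) hx
      (degree_le_of_natDegree_le ((natDegree_C_mul_le _ _).trans hdeg)) fun y hy => by
        rw [eval_C_mul, abs_mul, abs_div, hs, abs_of_pos hM, one_div_mul_eq_div, div_le_one hM]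
        exact hbnd y hy
    rw [Function.iterate_zero, id, id, eval_C_mul, div_mul_eq_mul_div, div_le_iff₀' hM] at h
    exact h
  refine abs_le'.mpr ⟨?_, ?_⟩
  · simpa using key 1 (by simp)
  · simpa using key (-1) (by simp)

/-- for a polynomial `q` of degree at most `2n` and `0 ≤ a < b`, the
maximum of `|q|` on `[a,b]` is at least `|q(0)| / T_{2n}((a+b)/(b−a))`. -/
theorem chebyshev_extremal (n : ℕ) (hn : 1 ≤ n) (q : Polynomial ℝ)
    (hq : q.natDegree ≤ 2 * n) (a b : ℝ) (ha : 0 ≤ a) (hab : a < b) :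
    ∃ z ∈ Set.Icc a b,
      |q.eval 0| / (Polynomial.Chebyshev.T ℝ (2 * n)).eval ((a + b) / (b - a)) ≤
        |q.eval z| := by
  have hba : 0 < b - a := sub_pos.mpr hab
  have hx : 1 ≤ (a + b) / (b - a) := (one_le_div hba).mpr (by linarith)
  have hT : 0 < (Polynomial.Chebyshev.T ℝ (2 * n)).eval ((a + b) / (b - a)) :=
    one_pos.trans_le (Polynomial.Chebyshev.one_le_eval_T_real _ hx)
  obtain ⟨z, hz, hmax⟩ := isCompact_Icc.exists_isMaxOn (Set.nonempty_Icc.mpr hab.le)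
    q.continuous.abs.continuousOn
  refine ⟨z, hz, le_of_forall_gt_imp_ge_of_dense fun M hM => ?_⟩
  let L : Polynomial ℝ := .C (-((b - a) / 2)) * .X + .C ((a + b) / 2)
  have hL (y : ℝ) : L.eval y = -((b - a) / 2) * y + (a + b) / 2 := by simp [L]
  have hdeg : (q.comp L).natDegree ≤ 2 * n :=
    Polynomial.natDegree_comp_le.trans <|
      (Nat.mul_le_mul hq Polynomial.natDegree_linear_le).trans_eq (mul_one _)
  have h := Polynomial.abs_eval_le_mul_eval_chebyshev_T ((abs_nonneg _).trans_lt hM) hx hdeg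
    fun y hy => by
      rw [Polynomial.eval_comp, hL]
      refine (hmax ⟨?_, ?_⟩).trans hM.le <;> nlinarith [hy.1, hy.2]
  have h_zero : L.eval ((a + b) / (b - a)) = 0 := by
    rw [hL]
    field_simp
    ring
  rw [Polynomial.eval_comp, h_zero] at h
  exact (div_le_iff₀ hT).mpr (by exact_mod_cast h)
end
end

section
/- There exists a universal constant C such that the following holds. Let n ≥ 1, let q be a polynomial with real coefficients of degree at most 2n, and let 0 < a < b. If z is drawn uniformly at random from the interval [a,b], then with probability at least 1/2, |q(z)| ≥ ((a+b)/(b−a))^{−2n} · e^{−C·n} · |q(0)|. -/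
open MeasureTheory ProbabilityTheory Filter
open scoped BigOperators

noncomputable section

/-- A set of reals of measure greater than `k * δ` contains `k + 1` points with consecutive gaps
at least `δ`. -/
theorem exists_separated_points {δ : ℝ} (hδ : 0 ≤ δ) (k : ℕ) (S : Set ℝ) (hS : BddBelow S)
    (hvol : ENNReal.ofReal (k * δ) < volume S) :
    ∃ x : ℕ → ℝ, (∀ i ≤ k, x i ∈ S) ∧
      ∀ i j, i ≤ j → j ≤ k → ((j : ℝ) - i) * δ ≤ x j - x i := by
  induction k generalizing S with
  | zero =>
    have hne : S.Nonempty := by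
      rw [Set.nonempty_iff_ne_empty]
      rintro rfl
      simp at hvol
    obtain ⟨y, hy⟩ := hne
    refine ⟨fun _ => y, fun _ _ => hy, fun i j hij hj => ?_⟩
    obtain rfl : j = 0 := by omega
    obtain rfl : i = 0 := by omega
    simp
  | succ k ih =>
    have hne : S.Nonempty := by
      rw [Set.nonempty_iff_ne_empty]
      rintro rfl
      simp at hvol
    obtain ⟨r, hr0, hr1, hr2⟩ := ENNReal.lt_iff_exists_real_btwn.1 hvol
    have hr : ((k + 1 : ℕ) : ℝ) * δ < r := by
      by_contra! h
      exact absurd hr1 (not_lt.2 (ENNReal.ofReal_le_ofReal h))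
    push_cast at hr
    obtain ⟨y, hyS, hy⟩ := exists_lt_of_csInf_lt hne
      (show sInf S < sInf S + (r - (k + 1) * δ) by linarith)
    have hcover : S ⊆ (S ∩ Set.Ici (y + δ)) ∪ Set.Icc (sInf S) (sInf S + (r - k * δ)) := by
      intro z hz
      by_cases h : y + δ ≤ z
      · exact Or.inl ⟨hz, h⟩
      · exact Or.inr ⟨csInf_le hS hz, by linarith⟩
    have hrest : ENNReal.ofReal (k * δ) < volume (S ∩ Set.Ici (y + δ)) := by
      by_contra! h
      have hle : volume S ≤ ENNReal.ofReal r := by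
        calc volume S ≤ volume (S ∩ Set.Ici (y + δ)) +
              volume (Set.Icc (sInf S) (sInf S + (r - k * δ))) :=
            (measure_mono hcover).trans (measure_union_le _ _)
          _ ≤ ENNReal.ofReal (k * δ) + ENNReal.ofReal (r - k * δ) := by
            gcongr
            rw [Real.volume_Icc]
            simp
          _ = ENNReal.ofReal r := by
            rw [← ENNReal.ofReal_add (by positivity) (by linarith)]
            congr 1
            ring
      exact absurd hr2 (not_lt.2 hle)
    obtain ⟨x, hxS, hx⟩ := ih _ (hS.mono Set.inter_subset_left) hrest
    refine ⟨fun i => if i = 0 then y else x (i - 1), fun i hi => ?_, fun i j hij hj => ?_⟩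
    · rcases i with _ | i
      · simpa using hyS
      · simpa using (hxS i (by omega)).1
    · rcases j with _ | j
      · obtain rfl : i = 0 := by omega
        simp
      rcases i with _ | i
      · have h0 : y + δ ≤ x 0 := (hxS 0 (by omega)).2
        have hj0 := hx 0 j (by omega) (by omega)
        simp only [Nat.add_eq_zero_iff, one_ne_zero, and_false, if_false, if_true,
          Nat.add_sub_cancel]
        push_cast at hj0 ⊢
        linarith
      · have hij' := hx i j (by omega) (by omega)
        simp only [Nat.add_eq_zero_iff, one_ne_zero, and_false, if_false,
          Nat.add_sub_cancel]
        push_cast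
        linarith

theorem prod_erase_abs_sub_eq_factorial_mul {d i : ℕ} (hi : i ≤ d) :
    ∏ j ∈ (Finset.range (d + 1)).erase i, |(i : ℝ) - j| = i.factorial * (d - i).factorial := by
  induction d, hi using Nat.le_induction with
  | base =>
    rw [Finset.range_add_one, Finset.erase_insert Finset.notMem_range_self, Nat.sub_self,
      ← Finset.prod_range_add_one_eq_factorial, ← Finset.prod_range_reflect]
    push_cast
    simp only [Nat.factorial_zero, Nat.cast_one, mul_one]
    refine Finset.prod_congr rfl fun j hj => ?_
    have hj : j < i := Finset.mem_range.1 hj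
    rw [Nat.sub_sub, Nat.cast_sub (by omega), sub_sub_cancel, Nat.abs_cast]
    push_cast
    ring
  | succ d hd ih =>
    rw [Finset.range_add_one, Finset.erase_insert_of_ne (by omega),
      Finset.prod_insert (by simp), ih, Nat.succ_sub hd, Nat.factorial_succ, abs_sub_comm,
      abs_of_pos (by rw [sub_pos]; exact_mod_cast Nat.lt_succ_of_le hd)]
    push_cast [Nat.cast_sub hd]
    ring

theorem sum_one_div_factorial_mul_factorial (d : ℕ) :
    ∑ i ∈ Finset.range (d + 1), (1 : ℝ) / (i.factorial * (d - i).factorial) =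
      2 ^ d / d.factorial := by
  have h : (2 : ℝ) ^ d = ∑ i ∈ Finset.range (d + 1), (d.choose i : ℝ) := by
    exact_mod_cast (Nat.sum_range_choose d).symm
  rw [h, Finset.sum_div]
  refine Finset.sum_congr rfl fun i hi => ?_
  rw [Nat.cast_choose ℝ (Nat.lt_succ_iff.1 (Finset.mem_range.1 hi))]
  field_simp

/-- Lagrange extrapolation to `0` from `δ`-separated nodes of absolute value at most `B`. -/
theorem abs_eval_zero_le_of_separated {d : ℕ} {q : Polynomial ℝ} (hq : q.natDegree ≤ d)
    {x : ℕ → ℝ} {δ B M : ℝ} (hδ : 0 < δ) (hB : ∀ i ≤ d, |x i| ≤ B)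
    (hM : ∀ i ≤ d, |q.eval (x i)| ≤ M)
    (hx : ∀ i j, i ≤ j → j ≤ d → ((j : ℝ) - i) * δ ≤ x j - x i) :
    |q.eval 0| ≤ M * ((B / δ) ^ d * (2 ^ d / d.factorial)) := by
  have hsep : ∀ i ≤ d, ∀ j ≤ d, |(i : ℝ) - j| * δ ≤ |x i - x j| := by
    intro i hi j hj
    rcases le_total i j with h | h
    · rw [abs_sub_comm, abs_sub_comm (x i),
        abs_of_nonneg (sub_nonneg.2 (by exact_mod_cast h : (i : ℝ) ≤ j))]
      exact (hx i j h hj).trans (le_abs_self _)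
    · rw [abs_of_nonneg (sub_nonneg.2 (by exact_mod_cast h : (j : ℝ) ≤ i))]
      exact (hx j i h hi).trans (le_abs_self _)
  have hne : ∀ i j : ℕ, i ≠ j → 0 < |(i : ℝ) - j| := fun i j h =>
    abs_pos.2 (sub_ne_zero.2 (by exact_mod_cast h))
  have hinj : Set.InjOn x (Finset.range (d + 1)) := by
    intro i hi j hj hij
    simp only [Finset.coe_range, Set.mem_Iio] at hi hj
    by_contra h
    have hs := hsep i (by omega) j (by omega)
    rw [hij, sub_self, abs_zero] at hs
    exact absurd hs (not_le.2 (mul_pos (hne i j h) hδ))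
  have hdeg : q.degree < (Finset.range (d + 1)).card := by
    rw [Finset.card_range]
    exact (Polynomial.natDegree_le_iff_degree_le.1 hq).trans_lt
      (by exact_mod_cast Nat.lt_succ_self d)
  have hbasis : ∀ i ∈ Finset.range (d + 1),
      |(Lagrange.basis (Finset.range (d + 1)) x i).eval 0| ≤
        (B / δ) ^ d * (1 / (i.factorial * (d - i).factorial)) := by
    intro i hi
    have hid : i ≤ d := Nat.lt_succ_iff.1 (Finset.mem_range.1 hi)
    have hcard : ((Finset.range (d + 1)).erase i).card = d := by
      rw [Finset.card_erase_of_mem hi, Finset.card_range, Nat.add_sub_cancel]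
    rw [Lagrange.basis, Polynomial.eval_prod, Finset.abs_prod,
      ← prod_erase_abs_sub_eq_factorial_mul hid, one_div, ← Finset.prod_inv_distrib]
    nth_rw 2 [← hcard]
    rw [← Finset.prod_const, ← Finset.prod_mul_distrib]
    refine Finset.prod_le_prod (fun _ _ => abs_nonneg _) fun j hj => ?_
    obtain ⟨hji, hj⟩ := Finset.mem_erase.1 hj
    have hjd : j ≤ d := Nat.lt_succ_iff.1 (Finset.mem_range.1 hj)
    have hpos := hne i j hji.symm
    have hB0 : 0 ≤ B := (abs_nonneg _).trans (hB j hjd)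
    calc |(Lagrange.basisDivisor (x i) (x j)).eval 0| = |x j| / |x i - x j| := by
          simp [Lagrange.basisDivisor, abs_mul, abs_inv, div_eq_inv_mul]
      _ ≤ B / (|(i : ℝ) - j| * δ) :=
          div_le_div₀ hB0 (hB j hjd) (mul_pos hpos hδ) (hsep i hid j hjd)
      _ = B / δ * |(i : ℝ) - j|⁻¹ := by field_simp
  have hM0 : 0 ≤ M := (abs_nonneg _).trans (hM 0 (Nat.zero_le d))
  rw [Lagrange.eq_interpolate hinj hdeg, Lagrange.interpolate_apply, Polynomial.eval_finsetSum,
    ← sum_one_div_factorial_mul_factorial, Finset.mul_sum, Finset.mul_sum]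
  refine (Finset.abs_sum_le_sum_abs _ _).trans (Finset.sum_le_sum fun i hi => ?_)
  rw [Polynomial.eval_mul, Polynomial.eval_C, abs_mul]
  exact mul_le_mul (hM i (Nat.lt_succ_iff.1 (Finset.mem_range.1 hi))) (hbasis i hi)
    (abs_nonneg _) hM0

/-- for a polynomial of degree at most `2n` and `0 < a < b`, a uniformly
random `z ∈ [a,b]` satisfies `|q(z)| ≥ ((a+b)/(b−a))^{−2n}·e^{−Cn}·|q(0)|` with
probability at least `1/2`. -/
theorem polynomial_anticoncentration_interval :
    ∃ C : ℝ, 0 < C ∧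
      ∀ (n : ℕ), 1 ≤ n → ∀ q : Polynomial ℝ, q.natDegree ≤ 2 * n →
      ∀ a b : ℝ, 0 < a → a < b →
        ENNReal.ofReal ((b - a) / 2) ≤
          MeasureTheory.volume
            {z ∈ Set.Icc a b |
              (((a + b) / (b - a)) ^ (2 * n))⁻¹ * Real.exp (-C * n) * |q.eval 0| ≤
                |q.eval z|} := by
  refine ⟨8, by norm_num, fun n hn q hq a b ha hab => ?_⟩
  set M := (((a + b) / (b - a)) ^ (2 * n))⁻¹ * Real.exp (-8 * n) * |q.eval 0| with hMdef
  by_contra! hgood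
  have hba : 0 < b - a := sub_pos.2 hab
  have hn0 : (0 : ℝ) < n := by exact_mod_cast hn
  have hbad : ENNReal.ofReal ((b - a) / 2) < volume {z ∈ Set.Icc a b | |q.eval z| < M} := by
    by_contra! h
    have hcover : Set.Icc a b ⊆ {z ∈ Set.Icc a b | M ≤ |q.eval z|} ∪
        {z ∈ Set.Icc a b | |q.eval z| < M} := fun z hz =>
      (le_or_gt M |q.eval z|).imp (fun h => ⟨hz, h⟩) fun h => ⟨hz, h⟩
    have hlt : ENNReal.ofReal (b - a) < ENNReal.ofReal (b - a) := by
      calc ENNReal.ofReal (b - a) = volume (Set.Icc a b) := Real.volume_Icc.symm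
        _ ≤ _ := (measure_mono hcover).trans (measure_union_le _ _)
        _ < ENNReal.ofReal ((b - a) / 2) + ENNReal.ofReal ((b - a) / 2) :=
          ENNReal.add_lt_add_of_lt_of_le (h.trans_lt ENNReal.ofReal_lt_top).ne hgood h
        _ = ENNReal.ofReal (b - a) := by
          rw [← ENNReal.ofReal_add (by positivity) (by positivity), add_halves]
    exact lt_irrefl _ hlt
  have hδ : 0 < (b - a) / (4 * n) := by positivity
  obtain ⟨x, hxS, hx⟩ := exists_separated_points hδ.le (2 * n)
    {z ∈ Set.Icc a b | |q.eval z| < M} ⟨a, fun z hz => hz.1.1⟩ (by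
      convert hbad using 2
      push_cast
      field_simp
      norm_num)
  have hM0 : 0 < M := (abs_nonneg _).trans_lt (hxS 0 (Nat.zero_le _)).2
  have hR : 0 < (a + b) / (b - a) := div_pos (by linarith) hba
  have hlag := abs_eval_zero_le_of_separated hq (B := a + b) hδ
    (fun i hi => by
      obtain ⟨h1, h2⟩ := (hxS i hi).1
      rw [abs_of_pos (ha.trans_le h1)]
      linarith)
    (fun i hi => (hxS i hi).2.le) hx
  have hconst : ((a + b) / ((b - a) / (4 * n))) ^ (2 * n) * (2 ^ (2 * n) / (2 * n).factorial) <
      ((a + b) / (b - a)) ^ (2 * n) * Real.exp (8 * n) := by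
    have hfact := Real.pow_div_factorial_le_exp ((2 * n : ℕ) : ℝ) (by positivity) (2 * n)
    have hfour : (4 : ℝ) ^ (2 * n) < Real.exp (6 * n) := by
      have h4 : (4 : ℝ) < Real.exp 3 := by
        have := Real.add_one_lt_exp (x := 3) (by norm_num)
        linarith
      calc (4 : ℝ) ^ (2 * n) < Real.exp 3 ^ (2 * n) :=
            pow_lt_pow_left₀ h4 (by norm_num) (by omega)
        _ = Real.exp (6 * n) := by
            rw [← Real.exp_nat_mul]
            congr 1
            push_cast
            ring
    calc ((a + b) / ((b - a) / (4 * n))) ^ (2 * n) * (2 ^ (2 * n) / (2 * n).factorial)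
        = ((a + b) / (b - a)) ^ (2 * n) *
            (4 ^ (2 * n) * (((2 * n : ℕ) : ℝ) ^ (2 * n) / (2 * n).factorial)) := by
          have h : (a + b) / ((b - a) / (4 * n)) * 2 =
              (a + b) / (b - a) * (4 * ((2 * n : ℕ) : ℝ)) := by
            push_cast
            field_simp
          rw [← mul_div_assoc, ← mul_pow, h, mul_pow, mul_pow]
          ring
      _ < ((a + b) / (b - a)) ^ (2 * n) * (Real.exp (6 * n) * Real.exp ((2 * n : ℕ) : ℝ)) := by
          exact mul_lt_mul_of_pos_left (mul_lt_mul hfour hfact (by positivity) (by positivity))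
            (by positivity)
      _ = ((a + b) / (b - a)) ^ (2 * n) * Real.exp (8 * n) := by
          rw [← Real.exp_add]
          congr 2
          push_cast
          ring
  have hMeq : M * (((a + b) / (b - a)) ^ (2 * n) * Real.exp (8 * n)) = |q.eval 0| := by
    rw [hMdef, neg_mul, Real.exp_neg]
    field_simp
  exact absurd (hlag.trans_lt (mul_lt_mul_of_pos_left hconst hM0)) (by rw [hMeq]; exact lt_irrefl _)
end
end

section
/- There exists a universal constant C such that the following holds. Let k, n ≥ 1, let q: ℝ^n → ℝ be a polynomial of degree at most k, and let z = (z_1,…,z_n) be a random vector with i.i.d. standard Gaussian coordinates. Then for every t ∈ ℝ and every δ > 0 with |t − E[q(z)]| > δ, Pr[ |q(z) − t| ≤ δ ] ≤ C·k·( δ / (|t − E[q(z)]| − δ) )^{2/(2k+1)}. -/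
open MeasureTheory ProbabilityTheory Filter
open scoped BigOperators

noncomputable section

section

open scoped ENNReal Pointwise

/-- One-dimensional Brunn–Minkowski inequality, in weighted form. -/
theorem volume_convexComb_le {A B C : Set ℝ} (hA : MeasurableSet A) (hB : MeasurableSet B)
    (hA0 : A.Nonempty) (hB0 : B.Nonempty) {r s : ℝ} (hr : 0 < r) (hs : 0 < s)
    (hC : ∀ x ∈ A, ∀ y ∈ B, r * x + s * y ∈ C) :
    ENNReal.ofReal r * volume A + ENNReal.ofReal s * volume B ≤ volume C := by
  obtain ⟨a₀, ha₀⟩ := hA0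
  obtain ⟨b₀, hb₀⟩ := hB0
  have key : ∀ K ⊆ A, IsCompact K → ∀ L ⊆ B, IsCompact L →
      ENNReal.ofReal r * volume K + ENNReal.ofReal s * volume L ≤ volume C := by
    intro K hKA hK L hLB hL
    have hK' : IsCompact (insert a₀ K) := hK.insert a₀
    have hL' : IsCompact (insert b₀ L) := hL.insert b₀
    obtain ⟨a, ha, hamax⟩ := hK'.exists_isGreatest (Set.insert_nonempty _ _)
    obtain ⟨b, hb, hbmin⟩ := hL'.exists_isLeast (Set.insert_nonempty _ _)
    have haA : a ∈ A := Set.insert_subset ha₀ hKA ha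
    have hbB : b ∈ B := Set.insert_subset hb₀ hLB hb
    have vol_image : ∀ (c d : ℝ), 0 < c → ∀ S : Set ℝ,
        volume ((fun x => c * x + d) '' S) = ENNReal.ofReal c * volume S := by
      intro c d hc S
      have : (fun x => c * x + d) '' S = (fun x => x + d) '' (c • S) := by
        ext z; simp [Set.mem_smul_set, ← sub_eq_add_neg, eq_sub_iff_add_eq]
      rw [this, Set.image_add_right, measure_preimage_add_right, Measure.addHaar_smul]
      simp [abs_of_pos hc]
    rw [← vol_image r (s * b) hr K, ← vol_image s (r * a) hs L]
    have hLc : IsCompact ((fun x => s * x + r * a) '' L) := hL.image (by fun_prop)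
    rw [← measure_union₀ hLc.measurableSet.nullMeasurableSet]
    · apply measure_mono
      rintro z (⟨x, hx, rfl⟩ | ⟨y, hy, rfl⟩)
      · exact hC x (hKA hx) b hbB
      · have := hC a haA y (hLB hy)
        simpa [add_comm] using this
    · apply measure_mono_null (t := {r * a + s * b})
      · rintro z ⟨⟨x, hx, rfl⟩, ⟨y, hy, hxy⟩⟩
        have h1 : x ≤ a := hamax (Set.mem_insert_of_mem _ hx)
        have h2 : b ≤ y := hbmin (Set.mem_insert_of_mem _ hy)
        simp only at hxy ⊢
        have h3 := mul_le_mul_of_nonneg_left h1 hr.le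
        have h4 := mul_le_mul_of_nonneg_left h2 hs.le
        show _ = _
        linarith
      · simp
  rw [hA.measure_eq_iSup_isCompact, hB.measure_eq_iSup_isCompact]
  simp only [ENNReal.mul_iSup, iSup_and']
  refine ENNReal.iSup_add_iSup_le fun K L => ?_
  by_cases hK : K ⊆ A ∧ IsCompact K
  · by_cases hL : L ⊆ B ∧ IsCompact L
    · simpa [hK, hL] using key K hK.1 hK.2 L hL.1 hL.2
    · have := key K hK.1 hK.2 ∅ (Set.empty_subset _) isCompact_empty
      simpa [hK, hL] using this
  · by_cases hL : L ⊆ B ∧ IsCompact L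
    · have := key ∅ (Set.empty_subset _) isCompact_empty L hL.1 hL.2
      simpa [hK, hL] using this
    · simp [hK, hL]

theorem lintegral_eq_lintegral_meas_gt_of_le_one {f : ℝ → ℝ≥0∞} (hf : Measurable f)
    (h1 : ∀ x, f x ≤ 1) :
    ∫⁻ x, f x = ∫⁻ t in Set.Ioo (0:ℝ) 1, volume {x | ENNReal.ofReal t < f x} := by
  have h2 : ∀ x, f x ≠ ⊤ := fun x => ((h1 x).trans_lt ENNReal.one_lt_top).ne
  have h3 : ∫⁻ x, f x = ∫⁻ x, ENNReal.ofReal (f x).toReal := by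
    simp_rw [ENNReal.ofReal_toReal (h2 _)]
  rw [h3, lintegral_eq_lintegral_meas_lt _ (ae_of_all _ fun x => ENNReal.toReal_nonneg)
    hf.ennreal_toReal.aemeasurable]
  have h4 : ∀ t ∈ Set.Ioi (0:ℝ), volume {x | t < (f x).toReal} =
      (Set.Ioo (0:ℝ) 1).indicator (fun t => volume {x | ENNReal.ofReal t < f x}) t := by
    intro t ht
    by_cases h : t < 1
    · rw [Set.indicator_of_mem (show t ∈ Set.Ioo (0:ℝ) 1 from ⟨ht, h⟩)]
      congr 1; ext x
      exact (ENNReal.ofReal_lt_iff_lt_toReal (le_of_lt ht) (h2 x)).symm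
    · rw [Set.indicator_of_notMem (fun h' => h h'.2)]
      convert measure_empty (μ := volume)
      ext x
      simp only [Set.mem_ofPred_eq, Set.mem_empty_iff_false, iff_false, not_lt]
      exact (ENNReal.toReal_mono ENNReal.one_ne_top (h1 x)).trans (by simpa using h)
  rw [setLIntegral_congr_fun measurableSet_Ioi h4, setLIntegral_indicator measurableSet_Ioo]
  congr 2
  ext; simp; tauto

theorem ENNReal.geom_mean_le {r s : ℝ} (hr : 0 < r) (hs : 0 < s) (hrs : r + s = 1) (a b : ℝ≥0∞) :
    a ^ r * b ^ s ≤ ENNReal.ofReal r * a + ENNReal.ofReal s * b := by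
  have hr' : ENNReal.ofReal r ≠ 0 := by simpa using hr
  have hs' : ENNReal.ofReal s ≠ 0 := by simpa using hs
  by_cases ha : a = ⊤
  · subst ha; simp [ENNReal.mul_top hr']
  by_cases hb : b = ⊤
  · subst hb; simp [ENNReal.mul_top hs']
  lift a to NNReal using ha
  lift b to NNReal using hb
  have h := NNReal.geom_mean_le_arith_mean2_weighted (⟨r, hr.le⟩ : NNReal) ⟨s, hs.le⟩ a b
    (by ext; exact hrs)
  rw [← ENNReal.coe_rpow_of_nonneg _ hr.le, ← ENNReal.coe_rpow_of_nonneg _ hs.le]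
  rw [ENNReal.ofReal_eq_coe_nnreal hr.le, ENNReal.ofReal_eq_coe_nnreal hs.le]
  exact_mod_cast h

theorem lt_geom_mean {r s : ℝ} (hr : 0 < r) (hs : 0 < s) (hrs : r + s = 1) {a b t : ℝ≥0∞}
    (ha : t < a) (hb : t < b) : t < a ^ r * b ^ s := by
  have ht : t ≠ ⊤ := ha.ne_top
  calc t = t ^ r * t ^ s := by
        rcases eq_or_ne t 0 with rfl | h0
        · simp [hr, hs]
        · rw [← ENNReal.rpow_add _ _ h0 ht, hrs, ENNReal.rpow_one]
    _ < a ^ r * b ^ s :=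
        ENNReal.mul_lt_mul (ENNReal.rpow_lt_rpow ha hr) (ENNReal.rpow_lt_rpow hb hs)

theorem prekopaLeindler_of_iSup_eq_one {f g h : ℝ → ℝ≥0∞} (hf : Measurable f) (hg : Measurable g)
    (hf1 : ⨆ x, f x = 1) (hg1 : ⨆ x, g x = 1)
    {r s : ℝ} (hr : 0 < r) (hs : 0 < s) (hrs : r + s = 1) (hh : Measurable h)
    (H : ∀ x y, f x ^ r * g y ^ s ≤ h (r * x + s * y)) :
    (∫⁻ x, f x) ^ r * (∫⁻ x, g x) ^ s ≤ ∫⁻ x, h x := by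
  have hfle : ∀ x, f x ≤ 1 := fun x => hf1 ▸ le_iSup f x
  have hgle : ∀ x, g x ≤ 1 := fun x => hg1 ▸ le_iSup g x
  refine (ENNReal.geom_mean_le hr hs hrs _ _).trans ?_
  calc _ ≤ ∫⁻ x, min (h x) 1 := ?_
    _ ≤ _ := lintegral_mono fun x => min_le_left _ _
  rw [lintegral_eq_lintegral_meas_gt_of_le_one hf hfle,
    lintegral_eq_lintegral_meas_gt_of_le_one hg hgle,
    lintegral_eq_lintegral_meas_gt_of_le_one (hh.min measurable_const) fun x => min_le_right _ _]
  have meas : ∀ u : ℝ → ℝ≥0∞, Measurable fun t : ℝ => volume {x | ENNReal.ofReal t < u x} := by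
    intro u
    refine Antitone.measurable fun a b hab => measure_mono fun x hx => ?_
    exact (ENNReal.ofReal_le_ofReal hab).trans_lt hx
  rw [← lintegral_const_mul _ (meas f), ← lintegral_const_mul _ (meas g),
    ← lintegral_add_left ((meas f).const_mul _)]
  refine setLIntegral_mono' measurableSet_Ioo fun t ht => ?_
  have ht1 : ENNReal.ofReal t < 1 := by
    rw [← ENNReal.ofReal_one]; exact (ENNReal.ofReal_lt_ofReal_iff one_pos).2 ht.2
  refine volume_convexComb_le (measurableSet_lt measurable_const hf)
    (measurableSet_lt measurable_const hg) ?_ ?_ hr hs ?_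
  · exact lt_iSup_iff.1 (hf1 ▸ ht1)
  · exact lt_iSup_iff.1 (hg1 ▸ ht1)
  · intro x hx y hy
    exact lt_min ((lt_geom_mean hr hs hrs hx hy).trans_le (H x y)) ht1

/-- One-dimensional Prékopa–Leindler inequality for bounded functions. -/
theorem prekopaLeindler_of_bounded {f g h : ℝ → ℝ≥0∞} (hf : Measurable f) (hg : Measurable g)
    (hf1 : ⨆ x, f x ≠ ⊤) (hg1 : ⨆ x, g x ≠ ⊤)
    {r s : ℝ} (hr : 0 < r) (hs : 0 < s) (hrs : r + s = 1) (hh : Measurable h)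
    (H : ∀ x y, f x ^ r * g y ^ s ≤ h (r * x + s * y)) :
    (∫⁻ x, f x) ^ r * (∫⁻ x, g x) ^ s ≤ ∫⁻ x, h x := by
  set a := ⨆ x, f x with ha
  set b := ⨆ x, g x with hb
  have hfle : ∀ x, f x ≤ a := le_iSup f
  have hgle : ∀ x, g x ≤ b := le_iSup g
  rcases eq_or_ne a 0 with h0 | h0
  · have : ∀ x, f x = 0 := fun x => le_antisymm (h0 ▸ hfle x) bot_le
    simp [this, hr]
  rcases eq_or_ne b 0 with h0' | h0'
  · have : ∀ x, g x = 0 := fun x => le_antisymm (h0' ▸ hgle x) bot_le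
    simp [this, hs]
  have har0 : a ^ r ≠ 0 := by simp [ENNReal.rpow_eq_zero_iff, h0, hf1]
  have hbs0 : b ^ s ≠ 0 := by simp [ENNReal.rpow_eq_zero_iff, h0', hg1]
  have hart : a ^ r ≠ ⊤ := ENNReal.rpow_ne_top_of_nonneg hr.le hf1
  have hbst : b ^ s ≠ ⊤ := ENNReal.rpow_ne_top_of_nonneg hs.le hg1
  have := prekopaLeindler_of_iSup_eq_one (f := fun x => a⁻¹ * f x) (g := fun x => b⁻¹ * g x)
    (h := fun x => (a ^ r * b ^ s)⁻¹ * h x) (hf.const_mul _) (hg.const_mul _)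
    (by rw [← ENNReal.mul_iSup, ← ha, ENNReal.inv_mul_cancel h0 hf1])
    (by rw [← ENNReal.mul_iSup, ← hb, ENNReal.inv_mul_cancel h0' hg1]) hr hs hrs (hh.const_mul _)
    (fun x y => by
      rw [ENNReal.mul_rpow_of_nonneg _ _ hr.le, ENNReal.mul_rpow_of_nonneg _ _ hs.le,
        ENNReal.inv_rpow, ENNReal.inv_rpow, ENNReal.mul_inv (Or.inl har0) (Or.inl hart)]
      calc _ = (a ^ r)⁻¹ * (b ^ s)⁻¹ * (f x ^ r * g y ^ s) := by ring
        _ ≤ _ := by gcongr; exact H x y)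
  rw [lintegral_const_mul _ hf, lintegral_const_mul _ hg, lintegral_const_mul _ hh,
    ENNReal.mul_rpow_of_nonneg _ _ hr.le, ENNReal.mul_rpow_of_nonneg _ _ hs.le,
        ENNReal.inv_rpow, ENNReal.inv_rpow, ENNReal.mul_inv (Or.inl har0) (Or.inl hart)] at this
  have h5 := mul_le_mul_right this (a ^ r * b ^ s)
  calc _ = (a ^ r * (a ^ r)⁻¹) * (b ^ s * (b ^ s)⁻¹) * ((∫⁻ x, f x) ^ r * (∫⁻ x, g x) ^ s) := by
        rw [ENNReal.mul_inv_cancel har0 hart, ENNReal.mul_inv_cancel hbs0 hbst]; ring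
    _ = a ^ r * b ^ s * ((a ^ r)⁻¹ * (∫⁻ x, f x) ^ r * ((b ^ s)⁻¹ * (∫⁻ x, g x) ^ s)) := by ring
    _ ≤ _ := h5
    _ = (a ^ r * (a ^ r)⁻¹) * (b ^ s * (b ^ s)⁻¹) * ∫⁻ x, h x := by ring
    _ = _ := by rw [ENNReal.mul_inv_cancel har0 hart, ENNReal.mul_inv_cancel hbs0 hbst]; ring

/-- One-dimensional Prékopa–Leindler inequality. -/
theorem prekopaLeindler_real {f g h : ℝ → ℝ≥0∞} (hf : Measurable f) (hg : Measurable g)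
    {r s : ℝ} (hr : 0 < r) (hs : 0 < s) (hrs : r + s = 1) (hh : Measurable h)
    (H : ∀ x y, f x ^ r * g y ^ s ≤ h (r * x + s * y)) :
    (∫⁻ x, f x) ^ r * (∫⁻ x, g x) ^ s ≤ ∫⁻ x, h x := by
  rcases eq_or_ne (∫⁻ x, f x) 0 with h0 | h0
  · simp [h0, hr]
  rcases eq_or_ne (∫⁻ x, g x) 0 with h0' | h0'
  · simp [h0', hs]
  have lim : ∀ u : ℝ → ℝ≥0∞, Measurable u →
      Tendsto (fun n : ℕ => ∫⁻ x, min (u x) n) atTop (nhds (∫⁻ x, u x)) := by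
    intro u hu
    refine lintegral_tendsto_of_tendsto_of_monotone
      (fun n => (hu.min measurable_const).aemeasurable)
      (ae_of_all _ fun x n m hnm => ?_) (ae_of_all _ fun x => ?_)
    · exact min_le_min_left _ (by exact_mod_cast hnm)
    · have : Tendsto (fun n : ℕ => min (u x) (n : ℝ≥0∞)) atTop (nhds (min (u x) ⊤)) :=
        tendsto_const_nhds.min ENNReal.tendsto_nat_nhds_top
      simpa using this
  have h1 := ENNReal.Tendsto.mul
    ((ENNReal.continuous_rpow_const (y := r)).continuousAt.tendsto.comp (lim f hf))
    (Or.inl (by simp [ENNReal.rpow_eq_zero_iff, h0, hr, hr.not_gt]))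
    ((ENNReal.continuous_rpow_const (y := s)).continuousAt.tendsto.comp (lim g hg))
    (Or.inl (by simp [ENNReal.rpow_eq_zero_iff, h0', hs, hs.not_gt]))
  refine le_of_tendsto' h1 fun n => ?_
  have hb : ∀ u : ℝ → ℝ≥0∞, ⨆ x, min (u x) (n : ℝ≥0∞) ≠ ⊤ := fun u =>
    ((iSup_le fun x => min_le_right _ _).trans_lt (ENNReal.natCast_lt_top n)).ne
  refine prekopaLeindler_of_bounded (hf.min measurable_const) (hg.min measurable_const)
    (hb f) (hb g) hr hs hrs hh fun x y => le_trans ?_ (H x y)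
  gcongr <;> exact min_le_left _ _

theorem convexComb_sq_le {r s : ℝ} (hr : 0 < r) (hs : 0 < s) (hrs : r + s = 1) (x y : ℝ) :
    (r * x + s * y) ^ 2 ≤ r * x ^ 2 + s * y ^ 2 := by
  obtain rfl : s = 1 - r := by linarith
  nlinarith [mul_nonneg (mul_pos hr hs).le (sq_nonneg (x - y))]

theorem gaussianPDF_geom_mean_le {r s : ℝ} (hr : 0 < r) (hs : 0 < s) (hrs : r + s = 1) (x y : ℝ) :
    gaussianPDF 0 1 x ^ r * gaussianPDF 0 1 y ^ s ≤ gaussianPDF 0 1 (r * x + s * y) := by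
  have hx := gaussianPDFReal_nonneg 0 1 x
  have hy := gaussianPDFReal_nonneg 0 1 y
  simp only [gaussianPDF]
  rw [ENNReal.ofReal_rpow_of_nonneg hx hr.le, ENNReal.ofReal_rpow_of_nonneg hy hs.le,
    ← ENNReal.ofReal_mul (by positivity)]
  refine ENNReal.ofReal_le_ofReal ?_
  simp only [gaussianPDFReal, sub_zero, NNReal.coe_one, mul_one]
  set A := (√(2 * Real.pi))⁻¹
  have hA : 0 < A := by positivity
  rw [Real.mul_rpow hA.le (Real.exp_pos _).le, Real.mul_rpow hA.le (Real.exp_pos _).le,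
    ← Real.exp_mul, ← Real.exp_mul]
  calc _ = (A ^ r * A ^ s) * Real.exp (-x ^ 2 / 2 * r + -y ^ 2 / 2 * s) := by
        rw [Real.exp_add]; ring
    _ = A * Real.exp (-x ^ 2 / 2 * r + -y ^ 2 / 2 * s) := by
        rw [← Real.rpow_add hA, hrs, Real.rpow_one]
    _ ≤ _ := by
        gcongr
        linarith [convexComb_sq_le hr hs hrs x y]

/-- Prékopa–Leindler inequality for the standard Gaussian measure on the line. -/
theorem prekopaLeindler_gaussianReal {f g h : ℝ → ℝ≥0∞} (hf : Measurable f) (hg : Measurable g)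
    {r s : ℝ} (hr : 0 < r) (hs : 0 < s) (hrs : r + s = 1) (hh : Measurable h)
    (H : ∀ x y, f x ^ r * g y ^ s ≤ h (r * x + s * y)) :
    (∫⁻ x, f x ∂gaussianReal 0 1) ^ r * (∫⁻ x, g x ∂gaussianReal 0 1) ^ s ≤
      ∫⁻ x, h x ∂gaussianReal 0 1 := by
  have hm := measurable_gaussianPDF 0 1
  rw [gaussianReal_of_var_ne_zero 0 one_ne_zero, lintegral_withDensity_eq_lintegral_mul _ hm hf,
    lintegral_withDensity_eq_lintegral_mul _ hm hg, lintegral_withDensity_eq_lintegral_mul _ hm hh]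
  refine prekopaLeindler_real (hm.mul hf) (hm.mul hg) hr hs hrs (hm.mul hh) fun x y => ?_
  simp only [Pi.mul_apply]
  rw [ENNReal.mul_rpow_of_nonneg _ _ hr.le, ENNReal.mul_rpow_of_nonneg _ _ hs.le]
  calc _ = (gaussianPDF 0 1 x ^ r * gaussianPDF 0 1 y ^ s) * (f x ^ r * g y ^ s) := by ring
    _ ≤ _ := mul_le_mul' (gaussianPDF_geom_mean_le hr hs hrs x y) (H x y)

/-- The standard Gaussian measure on `ℝⁿ`. -/
abbrev gaussianPi (n : ℕ) : Measure (Fin n → ℝ) := Measure.pi fun _ => gaussianReal 0 1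

theorem lintegral_gaussianPi_succ {n : ℕ} (i : Fin (n + 1)) {f : (Fin (n + 1) → ℝ) → ℝ≥0∞}
    (hf : Measurable f) :
    ∫⁻ z, f z ∂gaussianPi (n + 1) =
      ∫⁻ t, ∫⁻ y, f (i.insertNth t y) ∂gaussianPi n ∂gaussianReal 0 1 := by
  have h := (measurePreserving_piFinSuccAbove (fun _ : Fin (n + 1) => gaussianReal 0 1) i).symm
  have h2 := h.lintegral_comp hf
  rw [← h2, lintegral_prod _ (by
    exact (hf.comp (MeasurableEquiv.measurable _)).aemeasurable)]
  rfl

theorem measurable_insertNth {n : ℕ} (i : Fin (n + 1)) :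
    Measurable fun q : ℝ × (Fin n → ℝ) => (i.insertNth q.1 q.2 : Fin (n + 1) → ℝ) :=
  (MeasurableEquiv.piFinSuccAbove (fun _ : Fin (n + 1) => ℝ) i).symm.measurable

theorem insertNth_convexComb {n : ℕ} (i : Fin (n + 1)) (r s t u : ℝ) (x y : Fin n → ℝ) :
    (i.insertNth (r * t + s * u) (r • x + s • y) : Fin (n + 1) → ℝ) =
      r • (i.insertNth t x : Fin (n + 1) → ℝ) + s • (i.insertNth u y : Fin (n + 1) → ℝ) := by
  ext j
  refine Fin.succAboveCases i ?_ (fun j => ?_) j <;> simp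

/-- Prékopa–Leindler inequality for the standard Gaussian measure on `ℝⁿ`. -/
theorem prekopaLeindler_gaussianPi {n : ℕ} {f g h : (Fin n → ℝ) → ℝ≥0∞}
    (hf : Measurable f) (hg : Measurable g)
    {r s : ℝ} (hr : 0 < r) (hs : 0 < s) (hrs : r + s = 1) (hh : Measurable h)
    (H : ∀ x y, f x ^ r * g y ^ s ≤ h (r • x + s • y)) :
    (∫⁻ x, f x ∂gaussianPi n) ^ r * (∫⁻ x, g x ∂gaussianPi n) ^ s ≤ ∫⁻ x, h x ∂gaussianPi n := by
  induction n with
  | zero =>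
    have e : ∀ u : (Fin 0 → ℝ) → ℝ≥0∞, ∫⁻ x, u x ∂gaussianPi 0 = u 0 := fun u => by
      rw [gaussianPi, Measure.pi_of_empty _ 0, lintegral_dirac]
    simpa [e] using H 0 0
  | succ n ih =>
    rw [lintegral_gaussianPi_succ 0 hf, lintegral_gaussianPi_succ 0 hg,
      lintegral_gaussianPi_succ 0 hh]
    have meas : ∀ u : (Fin (n + 1) → ℝ) → ℝ≥0∞, Measurable u →
        Measurable fun t : ℝ => ∫⁻ y, u ((0 : Fin (n + 1)).insertNth t y) ∂gaussianPi n :=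
      fun u hu => Measurable.lintegral_prod_right'
        (f := fun q : ℝ × (Fin n → ℝ) => u ((0 : Fin (n + 1)).insertNth q.1 q.2))
        (hu.comp (measurable_insertNth 0))
    have meas' : ∀ (u : (Fin (n + 1) → ℝ) → ℝ≥0∞) (t : ℝ), Measurable u →
        Measurable fun y => u ((0 : Fin (n + 1)).insertNth t y) :=
      fun u t hu => hu.comp ((measurable_insertNth 0).comp measurable_prodMk_left)
    refine prekopaLeindler_gaussianReal (meas f hf) (meas g hg) hr hs hrs (meas h hh) fun t u => ?_
    refine ih (meas' f t hf) (meas' g u hg) (meas' h _ hh) fun x y => ?_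
    rw [insertNth_convexComb]
    exact H _ _

/-- The density of the `i`-th coordinate under the Gaussian measure restricted to `K`. -/
def sliceDensity {n : ℕ} (i : Fin (n + 1)) (K : Set (Fin (n + 1) → ℝ)) (t : ℝ) : ℝ≥0∞ :=
  gaussianPDF 0 1 t * gaussianPi n {y | i.insertNth t y ∈ K}

theorem measurable_sliceDensity {n : ℕ} (i : Fin (n + 1)) {K : Set (Fin (n + 1) → ℝ)}
    (hK : MeasurableSet K) : Measurable (sliceDensity i K) :=
  (measurable_gaussianPDF 0 1).mul (measurable_measure_prodMk_left (measurable_insertNth i hK))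

theorem gaussianPi_inter_preimage {n : ℕ} (i : Fin (n + 1)) {K : Set (Fin (n + 1) → ℝ)}
    (hK : MeasurableSet K) {S : Set ℝ} (hS : MeasurableSet S) :
    gaussianPi (n + 1) (K ∩ {z | z i ∈ S}) = ∫⁻ t in S, sliceDensity i K t := by
  have hS' : MeasurableSet {z : Fin (n + 1) → ℝ | z i ∈ S} := measurable_pi_apply i hS
  have hslice : Measurable fun t : ℝ => gaussianPi n {y | i.insertNth t y ∈ K} :=
    measurable_measure_prodMk_left (measurable_insertNth i hK)
  rw [← lintegral_indicator_one (hK.inter hS'),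
    lintegral_gaussianPi_succ i (measurable_one.indicator (hK.inter hS'))]
  have : ∀ t,
      ∫⁻ y, (K ∩ {z | z i ∈ S}).indicator 1 (i.insertNth t y : Fin (n + 1) → ℝ) ∂gaussianPi n
      = S.indicator (fun t => gaussianPi n {y | i.insertNth t y ∈ K}) t := by
    intro t
    by_cases ht : t ∈ S
    · have hm : MeasurableSet {y | (i.insertNth t y : Fin (n + 1) → ℝ) ∈ K} :=
        (measurable_insertNth i).comp measurable_prodMk_left hK
      rw [Set.indicator_of_mem ht, ← lintegral_indicator_one hm]
      congr with y
      have hy : (i.insertNth t y : Fin (n + 1) → ℝ) ∈ K ∩ {z | z i ∈ S} ↔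
          (i.insertNth t y : Fin (n + 1) → ℝ) ∈ K := by
        simp [ht]
      by_cases h : (i.insertNth t y : Fin (n + 1) → ℝ) ∈ K
      · exact (Set.indicator_of_mem (hy.2 h) _).trans (Set.indicator_of_mem h _).symm
      · exact (Set.indicator_of_notMem (fun h' => h (hy.1 h')) _).trans
          (Set.indicator_of_notMem (s := {y | i.insertNth t y ∈ K}) h _).symm
    · simp [Set.indicator, ht]
  simp_rw [this]
  rw [lintegral_indicator hS, gaussianReal_of_var_ne_zero 0 one_ne_zero,
    restrict_withDensity hS,
    lintegral_withDensity_eq_lintegral_mul _ (measurable_gaussianPDF 0 1) hslice]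
  rfl

theorem sliceDensity_geom_mean_le {n : ℕ} (i : Fin (n + 1)) {K : Set (Fin (n + 1) → ℝ)}
    (hK : MeasurableSet K) (hc : Convex ℝ K) {r s : ℝ} (hr : 0 < r) (hs : 0 < s) (hrs : r + s = 1)
    (t u : ℝ) : sliceDensity i K t ^ r * sliceDensity i K u ^ s ≤
      sliceDensity i K (r * t + s * u) := by
  have hm : ∀ t : ℝ, MeasurableSet {y | (i.insertNth t y : Fin (n + 1) → ℝ) ∈ K} := fun t =>
    (measurable_insertNth i).comp measurable_prodMk_left hK
  have h := prekopaLeindler_gaussianPi (measurable_one.indicator (hm t))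
    (measurable_one.indicator (hm u)) hr hs hrs (measurable_one.indicator (hm (r * t + s * u))) ?_
  · rw [lintegral_indicator_one (hm _), lintegral_indicator_one (hm _),
      lintegral_indicator_one (hm _)] at h
    unfold sliceDensity
    rw [ENNReal.mul_rpow_of_nonneg _ _ hr.le, ENNReal.mul_rpow_of_nonneg _ _ hs.le,
      mul_mul_mul_comm]
    exact mul_le_mul' (gaussianPDF_geom_mean_le hr hs hrs t u) h
  · intro x y
    by_cases hx : (i.insertNth t x : Fin (n + 1) → ℝ) ∈ K
    · by_cases hy : (i.insertNth u y : Fin (n + 1) → ℝ) ∈ K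
      · have : (i.insertNth (r * t + s * u) (r • x + s • y) : Fin (n + 1) → ℝ) ∈ K := by
          rw [insertNth_convexComb]; exact hc hx hy hr.le hs.le hrs
        simp [Set.indicator, hx, hy]
        rw [if_pos this]
      · simp [Set.indicator, hy, hs]
    · simp [Set.indicator, hx, hr]

theorem sliceDensity_le_one {n : ℕ} (i : Fin (n + 1)) (K : Set (Fin (n + 1) → ℝ)) (t : ℝ) :
    sliceDensity i K t ≤ 1 := by
  refine mul_le_one' ?_ prob_le_one
  rw [gaussianPDF, ENNReal.ofReal_le_one]
  simp only [gaussianPDFReal, NNReal.coe_one, mul_one]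
  refine mul_le_one₀ (inv_le_one_of_one_le₀ ?_) (Real.exp_pos _).le ?_
  · rw [Real.one_le_sqrt]; nlinarith [Real.pi_gt_three]
  · rw [Real.exp_le_one_iff]; nlinarith [sq_nonneg (t - 0)]

/-- A log-concave probability density on the line decays exponentially at its own scale. -/
theorem exists_exp_decay_of_logConcave {w : ℝ → ℝ} (h0 : ∀ t, 0 ≤ w t)
    (hb : BddAbove (Set.range w))
    (hw : ∀ ⦃r s : ℝ⦄, 0 < r → 0 < s → r + s = 1 → ∀ t u, w t ^ r * w u ^ s ≤ w (r * t + s * u))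
    (h1 : ∫⁻ t, ENNReal.ofReal (w t) = 1) :
    ∃ c T : ℝ, 0 < T ∧ ∀ y, T * w (c + T * y) ≤ 32 * Real.exp (-|y|) := by
  set M := sSup (Set.range w) with hM
  have hwM : ∀ t, w t ≤ M := fun t => le_csSup hb ⟨t, rfl⟩
  have hMpos : 0 < M := by
    by_contra hneg
    have : ∀ t, ENNReal.ofReal (w t) = 0 := fun t =>
      ENNReal.ofReal_eq_zero.2 ((hwM t).trans (not_lt.1 hneg))
    simp [this] at h1
  obtain ⟨_, ⟨c, rfl⟩, hc⟩ := exists_lt_of_lt_csSup (Set.range_nonempty w)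
    (show M / 2 < sSup (Set.range w) by linarith)
  have hcpos : 0 < w c := by linarith
  have hT : 0 < 8 / M := by positivity
  have hTM : 8 / M * M = 8 := by field_simp
  have key : ∀ σ : ℝ, |σ| = 1 → w (c + σ * (8 / M)) ≤ M / 8 := by
    intro σ hσ
    by_contra! hlt
    set v := min (w c) (w (c + σ * (8 / M)))
    have hv : M / 8 < v := lt_min (by linarith) hlt
    have hv0 : 0 < v := by linarith
    have hmin : ∀ s ∈ Set.Ioo (0 : ℝ) 1, v ≤ w (c + s * (σ * (8 / M))) := by
      rintro s ⟨hs0, hs1⟩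
      have h := hw (sub_pos.2 hs1) hs0 (by ring) c (c + σ * (8 / M))
      calc v = v ^ (1 - s) * v ^ s := by rw [← Real.rpow_add hv0]; simp
        _ ≤ w c ^ (1 - s) * w (c + σ * (8 / M)) ^ s := by
          have : 0 ≤ 1 - s := by linarith
          gcongr
          · exact min_le_left _ _
          · exact min_le_right _ _
        _ ≤ _ := h
        _ = _ := by congr 1; ring
    have hlow : ∀ a b : ℝ, b - a = 8 / M → (∀ t ∈ Set.Ioo a b, v ≤ w t) → False := by
      intro a b hab hge
      have h2 : ENNReal.ofReal (v * (8 / M)) ≤ 1 := by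
        calc ENNReal.ofReal (v * (8 / M)) = ∫⁻ _ in Set.Ioo a b, ENNReal.ofReal v := by
              rw [setLIntegral_const, Real.volume_Ioo, hab, ENNReal.ofReal_mul hv0.le]
          _ ≤ ∫⁻ t in Set.Ioo a b, ENNReal.ofReal (w t) :=
              setLIntegral_mono' measurableSet_Ioo fun t ht =>
                ENNReal.ofReal_le_ofReal (hge t ht)
          _ ≤ _ := setLIntegral_le_lintegral _ _
          _ = 1 := h1
      rw [ENNReal.ofReal_le_one] at h2
      nlinarith
    rcases eq_or_eq_neg_of_abs_eq hσ with rfl | rfl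
    · refine hlow c (c + 8 / M) (by ring) fun t ht => ?_
      have := hmin ((t - c) / (8 / M)) ⟨div_pos (by linarith [ht.1]) hT,
        (div_lt_one hT).2 (by linarith [ht.2])⟩
      rwa [one_mul, div_mul_cancel₀ _ hT.ne', add_sub_cancel] at this
    · refine hlow (c - 8 / M) c (by ring) fun t ht => ?_
      have := hmin ((c - t) / (8 / M)) ⟨div_pos (by linarith [ht.2]) hT,
        (div_lt_one hT).2 (by linarith [ht.1])⟩
      rw [neg_one_mul, mul_neg, div_mul_cancel₀ _ hT.ne'] at this
      convert this using 2; ring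
  refine ⟨c, 8 / M, hT, fun y => ?_⟩
  rcases le_or_gt |y| 1 with hy | hy
  · have h3 : Real.exp 1 * Real.exp (-|y|) ≥ 1 := by
      rw [← Real.exp_add]; exact Real.one_le_exp (by linarith)
    have h4 := Real.exp_one_lt_d9
    have := mul_le_mul_of_nonneg_left (hwM (c + 8 / M * y)) hT.le
    nlinarith [Real.exp_pos (-|y|)]
  · have hY : 0 < |y| := by linarith
    have hy0 : y ≠ 0 := abs_pos.1 hY
    have hσ : abs (y / |y|) = 1 := by rw [abs_div, abs_abs, div_self hY.ne']
    have h5 := key _ hσ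
    have hinv : |y|⁻¹ < 1 := inv_lt_one_of_one_lt₀ hy
    have h6 := hw (sub_pos.2 hinv) (inv_pos.2 hY) (by ring) c (c + 8 / M * y)
    rw [show (1 - |y|⁻¹) * c + |y|⁻¹ * (c + 8 / M * y) = c + y / |y| * (8 / M) by ring] at h6
    have hx := h0 (c + 8 / M * y)
    set x := w (c + 8 / M * y)
    have h7 : (M / 2) ^ (1 - |y|⁻¹) * x ^ |y|⁻¹ ≤ M / 8 := by
      refine le_trans ?_ (h6.trans h5)
      gcongr
    have h8 : (M / 2) ^ (|y| - 1) * x ≤ (M / 8) ^ |y| := by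
      have := Real.rpow_le_rpow (by positivity) h7 hY.le
      rw [Real.mul_rpow (by positivity) (by positivity), ← Real.rpow_mul (by positivity),
        ← Real.rpow_mul hx, inv_mul_cancel₀ hY.ne', Real.rpow_one] at this
      convert this using 3
      field_simp
    have h9 : (M / 8) ^ |y| = (M / 2) ^ (|y| - 1) * (M / 2 * (1 / 4) ^ |y|) := by
      rw [← mul_assoc, Real.rpow_sub_one (by positivity),
        div_mul_cancel₀ _ (by positivity), ← Real.mul_rpow (by positivity) (by positivity)]
      congr 1; ring
    rw [h9] at h8
    have h10 : x ≤ M / 2 * (1 / 4) ^ |y| := le_of_mul_le_mul_left h8 (by positivity)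
    have h11 : ((1 : ℝ) / 4) ^ |y| ≤ Real.exp (-|y|) := by
      rw [Real.exp_neg, ← Real.exp_one_rpow, ← Real.inv_rpow (Real.exp_pos 1).le]
      gcongr
      rw [one_div]
      gcongr
      linarith [Real.exp_one_lt_d9]
    calc 8 / M * x ≤ 8 / M * (M / 2 * (1 / 4) ^ |y|) := by gcongr
      _ = 4 * (1 / 4) ^ |y| := by field_simp; norm_num
      _ ≤ _ := by nlinarith [Real.exp_pos (-|y|)]

theorem prod_range_erase_abs_sub {i k : ℕ} (h : i ≤ k) :
    ∏ j ∈ (Finset.range (k + 1)).erase i, |(i : ℝ) - j| =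
      (i.factorial * (k - i).factorial : ℕ) := by
  induction k, h using Nat.le_induction with
  | base =>
    have : (Finset.range (i + 1)).erase i = Finset.range i := by
      ext j; simp only [Finset.mem_erase, Finset.mem_range]; lia
    rw [this, ← Finset.prod_range_reflect, ← Finset.prod_range_add_one_eq_factorial]
    simp only [Nat.sub_self, Nat.factorial_zero, mul_one, Nat.cast_prod]
    refine Finset.prod_congr rfl fun j hj => ?_
    rw [Finset.mem_range] at hj
    rw [show i - 1 - j = i - (j + 1) by lia, Nat.cast_sub hj, sub_sub_cancel, Nat.abs_cast]
  | succ k h ih =>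
    have : (Finset.range (k + 1 + 1)).erase i =
        insert (k + 1) ((Finset.range (k + 1)).erase i) := by
      ext j; simp only [Finset.mem_erase, Finset.mem_range, Finset.mem_insert]; lia
    rw [this, Finset.prod_insert (by simp), ih, Nat.succ_sub h, Nat.factorial_succ,
      abs_sub_comm, ← Nat.cast_sub (by lia), Nat.abs_cast, Nat.succ_sub h]
    push_cast; ring

theorem sum_inv_factorial_mul_factorial (k : ℕ) :
    ∑ i ∈ Finset.range (k + 1), ((i.factorial * (k - i).factorial : ℕ) : ℝ)⁻¹ =
      2 ^ k / k.factorial := by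
  rw [eq_div_iff (by positivity), Finset.sum_mul, ← Nat.cast_ofNat (R := ℝ), ← Nat.cast_pow,
    ← Nat.sum_range_choose, Nat.cast_sum]
  refine Finset.sum_congr rfl fun i hi => ?_
  have hi' : i ≤ k := Nat.lt_succ_iff.1 (Finset.mem_range.1 hi)
  rw [← Nat.choose_mul_factorial_mul_factorial hi']
  push_cast
  field_simp

/-- A polynomial that is bounded at `k + 1` well-spread nodes is bounded everywhere. -/
theorem Polynomial.abs_eval_le_of_spread_nodes {P : Polynomial ℝ} {k : ℕ} (hP : P.natDegree ≤ k)
    {p : ℕ → ℝ} (hp : ∀ i ≤ k, 0 ≤ p i) {ε h : ℝ} (hε : 0 ≤ ε) (hh : 0 < h)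
    (hPp : ∀ i ≤ k, |P.eval (p i)| ≤ ε)
    (hsep : ∀ i ≤ k, ∀ j ≤ k, (1 + p i) * (1 + p j) * |(i : ℝ) - j| * h ≤ |p i - p j|) (x : ℝ) :
    |P.eval x| ≤ ε * (4 / h) ^ k * Real.exp ((1 + |x|) / 2) := by
  have hpos : ∀ i ≤ k, 0 < 1 + p i := fun i hi => by linarith [hp i hi]
  have hne : ∀ i ≤ k, ∀ j ≤ k, i ≠ j → 0 < |(i : ℝ) - j| := fun i _ j _ hij =>
    abs_pos.2 (sub_ne_zero.2 (Nat.cast_injective.ne hij))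
  have hinj : Set.InjOn p (Finset.range (k + 1) : Finset ℕ) := by
    intro i hi j hj hij
    by_contra hne'
    simp only [Finset.coe_range, Set.mem_Iio, Nat.lt_succ_iff] at hi hj
    have h1 := hsep i hi j hj
    rw [hij, sub_self, abs_zero] at h1
    have := mul_pos (mul_pos (mul_pos (hpos j hj) (hpos j hj)) (hne i hi j hj hne')) hh
    linarith
  have hdeg : P.degree < (Finset.range (k + 1)).card := by
    rw [Finset.card_range]
    exact (Polynomial.degree_le_natDegree.trans (Nat.cast_le.2 hP)).trans_lt
      (Nat.cast_lt.2 k.lt_succ_self)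
  have hx0 : 0 ≤ 1 + |x| := by positivity
  have hbasis : ∀ i ∈ Finset.range (k + 1),
      |∏ j ∈ (Finset.range (k + 1)).erase i, (p i - p j)⁻¹ * (x - p j)| ≤
        ((1 + |x|) / h) ^ k * ((i.factorial * (k - i).factorial : ℕ) : ℝ)⁻¹ := by
    intro i hi
    have hi' : i ≤ k := Nat.lt_succ_iff.1 (Finset.mem_range.1 hi)
    have hc : ((Finset.range (k + 1)).erase i).card = k := by
      rw [Finset.card_erase_of_mem hi, Finset.card_range, Nat.add_sub_cancel]
    rw [← prod_range_erase_abs_sub hi', ← Finset.prod_inv_distrib]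
    nth_rw 2 [← hc]
    rw [← Finset.prod_const, ← Finset.prod_mul_distrib, Finset.abs_prod]
    refine Finset.prod_le_prod (fun _ _ => abs_nonneg _) fun j hj => ?_
    obtain ⟨hji, hj⟩ := Finset.mem_erase.1 hj
    have hj' : j ≤ k := Nat.lt_succ_iff.1 (Finset.mem_range.1 hj)
    have h1 := hsep i hi' j hj'
    have h2 := hne i hi' j hj' hji.symm
    have h3 : |x - p j| ≤ (1 + |x|) * (1 + p j) := by
      refine (abs_sub _ _).trans ?_
      rw [abs_of_nonneg (hp j hj')]
      nlinarith [hp j hj', abs_nonneg x, mul_nonneg (abs_nonneg x) (hp j hj')]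
    have h4 : (1 + p j) * (|(i : ℝ) - j| * h) ≤ |p i - p j| := by
      refine le_trans ?_ h1
      have : 0 ≤ p i * ((1 + p j) * (|(i : ℝ) - j| * h)) :=
        mul_nonneg (hp i hi') (mul_pos (hpos j hj') (mul_pos h2 hh)).le
      nlinarith
    have h5 := mul_pos (hpos j hj') (mul_pos h2 hh)
    rw [abs_mul, abs_inv, ← div_eq_inv_mul]
    calc |x - p j| / |p i - p j| ≤ (1 + |x|) * (1 + p j) / ((1 + p j) * (|(i : ℝ) - j| * h)) := by
          have := hpos j hj'
          gcongr
      _ = _ := by have := (hpos j hj').ne'; field_simp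
  rw [Lagrange.eq_interpolate hinj hdeg, Lagrange.interpolate_apply, Polynomial.eval_finsetSum]
  simp only [Polynomial.eval_mul, Polynomial.eval_C, Lagrange.basis, Polynomial.eval_prod,
    Lagrange.basisDivisor, Polynomial.eval_sub, Polynomial.eval_X]
  calc _ ≤ ∑ i ∈ Finset.range (k + 1), |P.eval (p i) *
          ∏ j ∈ (Finset.range (k + 1)).erase i, (p i - p j)⁻¹ * (x - p j)| :=
        Finset.abs_sum_le_sum_abs _ _
    _ ≤ ∑ i ∈ Finset.range (k + 1), ε * (((1 + |x|) / h) ^ k *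
          ((i.factorial * (k - i).factorial : ℕ) : ℝ)⁻¹) := by
        refine Finset.sum_le_sum fun i hi => ?_
        rw [abs_mul]
        exact mul_le_mul (hPp i (Nat.lt_succ_iff.1 (Finset.mem_range.1 hi))) (hbasis i hi)
          (abs_nonneg _) hε
    _ = ε * (4 / h) ^ k * (((1 + |x|) / 2) ^ k / k.factorial) := by
        rw [← Finset.mul_sum, ← Finset.mul_sum, sum_inv_factorial_mul_factorial,
          show (1 + |x|) / h = (4 / h) * ((1 + |x|) / 2) * (1 / 2) by ring, mul_pow, mul_pow,
          one_div, inv_pow]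
        field_simp
    _ ≤ _ := by
        gcongr
        exact Real.pow_div_factorial_le_exp _ (by positivity) _

/-- Points of a set of measure at least `b` in `[0, ∞)` with large measure in between. -/
theorem exists_spread_points {ν : Measure ℝ} [IsFiniteMeasure ν] [NullSingletonClass ν] {B : Set ℝ}
    {b : ℝ} (hb : 0 < b) (hBb : b ≤ ν.real (B ∩ Set.Ioi 0)) (k : ℕ) :
    ∃ p : ℕ → ℝ, (∀ i ≤ k, 0 ≤ p i ∧ p i ∈ B) ∧ ∀ i j, i < j → j ≤ k → p i ≤ p j ∧
      ((j : ℝ) - i) * (b / (2 * k + 2)) ≤ ν.real (Set.Ioc (p i) (p j)) := by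
  set μ := ν.restrict B with hμ
  set F : ℝ → ℝ := fun y => ∫ _ in (0 : ℝ)..y, (1 : ℝ) ∂μ with hF
  have hFcont : Continuous F := intervalIntegral.continuous_primitive
    (fun _ _ => intervalIntegrable_const) 0
  have hFsub : ∀ u v, u ≤ v → F v - F u = μ.real (Set.Ioc u v) := fun u v huv => by
    rw [hF, intervalIntegral.integral_interval_sub_left intervalIntegrable_const
      intervalIntegrable_const, intervalIntegral.integral_of_le huv]
    simp
  have hF0 : F 0 = 0 := by simp [hF]
  have hFlim : Tendsto F atTop (nhds (μ.real (Set.Ioi 0))) := by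
    have := intervalIntegral_tendsto_integral_Ioi (f := fun _ => (1 : ℝ)) (μ := μ) 0
      (integrable_const _).integrableOn tendsto_id
    simpa using this
  have hμb : b ≤ μ.real (Set.Ioi 0) := by
    rwa [hμ, measureReal_restrict_apply measurableSet_Ioi, Set.inter_comm]
  have hex : ∀ l : ℕ, ∃ y, l ≤ 2 * k + 1 → 0 ≤ y ∧ F y = l * (b / (2 * k + 2)) := by
    intro l
    by_cases hl : l ≤ 2 * k + 1
    · have hlb : (l : ℝ) * (b / (2 * k + 2)) < μ.real (Set.Ioi 0) := by
        refine lt_of_lt_of_le ?_ hμb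
        rw [mul_div_assoc', div_lt_iff₀ (by positivity), mul_comm]
        have : (l : ℝ) < 2 * k + 2 := by exact_mod_cast Nat.lt_succ_of_le hl
        gcongr
      obtain ⟨Y, hY, hY0⟩ := ((hFlim.eventually_const_lt hlb).and (eventually_ge_atTop 0)).exists
      obtain ⟨y, hy, hy'⟩ := intermediate_value_Icc hY0 hFcont.continuousOn
        (show (l : ℝ) * (b / (2 * k + 2)) ∈ Set.Icc (F 0) (F Y) from
          ⟨by rw [hF0]; positivity, hY.le⟩)
      exact ⟨y, fun _ => ⟨hy.1, hy'⟩⟩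
    · exact ⟨0, fun h => absurd h hl⟩
  choose y hy using hex
  have hbk : 0 < b / (2 * k + 2) := by positivity
  have hmono : ∀ l m, l < m → m ≤ 2 * k + 1 → y l < y m := by
    intro l m hlm hm
    by_contra! hle
    have h1 := hFsub _ _ hle
    rw [(hy l (by lia)).2, (hy m hm).2, ← sub_mul] at h1
    have h2 : (0 : ℝ) ≤ μ.real (Set.Ioc (y m) (y l)) := measureReal_nonneg
    have h3 : (l : ℝ) < m := by exact_mod_cast hlm
    nlinarith
  have hmeas : ∀ l m, l < m → m ≤ 2 * k + 1 →
      μ.real (Set.Ioc (y l) (y m)) = ((m : ℝ) - l) * (b / (2 * k + 2)) := by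
    intro l m hlm hm
    rw [← hFsub _ _ (hmono l m hlm hm).le, (hy l (by lia)).2, (hy m hm).2, ← sub_mul]
  have hpt : ∀ i : ℕ, ∃ p, i ≤ k → p ∈ B ∩ Set.Ioc (y (2 * i)) (y (2 * i + 1)) := by
    intro i
    by_cases hi : i ≤ k
    · have h1 := hmeas (2 * i) (2 * i + 1) (by lia) (by lia)
      have h2 : (B ∩ Set.Ioc (y (2 * i)) (y (2 * i + 1))).Nonempty := by
        by_contra hemp
        rw [hμ, measureReal_restrict_apply measurableSet_Ioc, Set.inter_comm,
          Set.not_nonempty_iff_eq_empty.1 hemp, measureReal_empty] at h1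
        push_cast at h1
        linarith
      exact ⟨h2.some, fun _ => h2.some_mem⟩
    · exact ⟨0, fun h => absurd h hi⟩
  choose p hp using hpt
  refine ⟨p, fun i hi => ⟨?_, (hp i hi).1⟩, fun i j hij hj => ?_⟩
  · exact (hy (2 * i) (by lia)).1.trans (hp i hi).2.1.le
  · have hi := hp i (by lia)
    have hj' := hp j hj
    have hyy := hmono (2 * i + 1) (2 * j) (by lia) (by lia)
    refine ⟨by linarith [hi.2.2, hj'.2.1], ?_⟩
    calc ((j : ℝ) - i) * (b / (2 * k + 2))
        ≤ (((2 * j : ℕ) : ℝ) - ((2 * i + 1 : ℕ) : ℝ)) * (b / (2 * k + 2)) := by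
          have : (i : ℝ) + 1 ≤ j := by exact_mod_cast hij
          refine mul_le_mul_of_nonneg_right ?_ hbk.le
          push_cast
          linarith
      _ = μ.real (Set.Ioc (y (2 * i + 1)) (y (2 * j))) :=
          (hmeas (2 * i + 1) (2 * j) (by lia) (by lia)).symm
      _ ≤ μ.real (Set.Ioc (p i) (p j)) :=
          measureReal_mono (Set.Ioc_subset_Ioc hi.2.2 hj'.2.1.le)
      _ ≤ _ := by
          rw [hμ, measureReal_restrict_apply measurableSet_Ioc]
          exact measureReal_mono Set.inter_subset_left

theorem lintegral_exp_neg_abs_half :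
    ∫⁻ x : ℝ, ENNReal.ofReal (Real.exp (-|x| / 2)) = ENNReal.ofReal 4 := by
  have h : ∫ x : ℝ, Real.exp (-|x| / 2) = 4 := by
    rw [integral_comp_abs (f := fun x => Real.exp (-x / 2))]
    have := integral_exp_mul_Ioi (a := -1 / 2) (by norm_num) 0
    simp only [mul_zero, Real.exp_zero] at this
    rw [show (fun x : ℝ => Real.exp (-x / 2)) = fun x => Real.exp (-1 / 2 * x) from
      funext fun x => by ring_nf, this]
    norm_num
  rw [← h, ofReal_integral_eq_lintegral_ofReal
    (Integrable.of_integral_ne_zero (by rw [h]; norm_num))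
    (Eventually.of_forall fun x => (Real.exp_pos _).le)]

/-- The density `32 * exp (-|y|)`, dominating normalized one-dimensional marginals. -/
abbrev expDensity (y : ℝ) : ℝ≥0∞ := ENNReal.ofReal (32 * Real.exp (-|y|))

theorem measureReal_Ioc_le {ν : Measure ℝ} (hν : ν ≤ volume.withDensity expDensity) {u v : ℝ}
    (hu : 0 ≤ u) (huv : u ≤ v) : ν.real (Set.Ioc u v) ≤ 64 * (1 / (1 + u) - 1 / (1 + v)) := by
  have hpos : ∀ y ∈ Set.uIcc u v, 0 < 1 + y := fun y hy => by
    rw [Set.uIcc_of_le huv] at hy; linarith [hy.1]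
  have hcont : ContinuousOn (fun y : ℝ => 64 / (1 + y) ^ 2) (Set.uIcc u v) := by
    refine ContinuousOn.div (by fun_prop) (by fun_prop) fun y hy => ?_
    have := hpos y hy
    positivity
  have hint : ∫ y in u..v, 64 / (1 + y) ^ 2 = 64 * (1 / (1 + u) - 1 / (1 + v)) := by
    rw [intervalIntegral.integral_eq_sub_of_hasDerivAt (f := fun y => -64 * (1 + y)⁻¹)
      (fun y hy => ?_) hcont.intervalIntegrable]
    · ring
    · have h : HasDerivAt (fun y : ℝ => -64 * (1 + y)⁻¹) (-64 * (-1 / (1 + y) ^ 2)) y :=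
        (((hasDerivAt_id y).const_add 1).inv (hpos y hy).ne').const_mul (-64)
      exact h.congr_deriv (by ring)
  have hnn : 0 ≤ 64 * (1 / (1 + u) - 1 / (1 + v)) := by
    have : 1 / (1 + v) ≤ 1 / (1 + u) := by gcongr
    linarith
  rw [measureReal_def]
  refine ENNReal.toReal_le_of_le_ofReal hnn ?_
  calc ν (Set.Ioc u v) ≤ volume.withDensity expDensity (Set.Ioc u v) := hν _
    _ = ∫⁻ y in Set.Ioc u v, expDensity y := withDensity_apply _ measurableSet_Ioc
    _ ≤ ∫⁻ y in Set.Ioc u v, ENNReal.ofReal (64 / (1 + y) ^ 2) := by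
        refine setLIntegral_mono' measurableSet_Ioc fun y hy => ENNReal.ofReal_le_ofReal ?_
        have hy0 : 0 ≤ y := hu.trans hy.1.le
        have hexp := Real.quadratic_le_exp_of_nonneg hy0
        rw [abs_of_nonneg hy0, Real.exp_neg, ← div_eq_mul_inv, div_le_div_iff₀ (Real.exp_pos _)
          (by positivity)]
        nlinarith
    _ = ENNReal.ofReal (∫ y in u..v, 64 / (1 + y) ^ 2) := by
        rw [intervalIntegral.integral_of_le huv, ofReal_integral_eq_lintegral_ofReal]
        · exact ((intervalIntegrable_iff_integrableOn_Ioc_of_le huv).1 hcont.intervalIntegrable)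
        · exact Eventually.of_forall fun y => by positivity
    _ = _ := by rw [hint]

theorem nullSingletonClass_of_le_withDensity {ν : Measure ℝ}
    (hν : ν ≤ volume.withDensity expDensity) : NullSingletonClass ν :=
  ⟨fun x => (hν.absolutelyContinuous.trans (withDensity_absolutelyContinuous _ _))
    (measure_singleton x)⟩

theorem Polynomial.abs_eval_le_of_measure_Ioi {ν : Measure ℝ} [IsFiniteMeasure ν]
    (hν : ν ≤ volume.withDensity expDensity) {P : Polynomial ℝ} {k : ℕ} (hP : P.natDegree ≤ k)
    {ε b : ℝ} (hε : 0 ≤ ε) (hb : 0 < b)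
    (h : b ≤ ν.real ({x | |P.eval x| ≤ ε} ∩ Set.Ioi 0)) (x : ℝ) :
    |P.eval x| ≤ ε * (512 * (k + 1) / b) ^ k * Real.exp ((1 + |x|) / 2) := by
  have := nullSingletonClass_of_le_withDensity hν
  obtain ⟨p, hp, hpp⟩ := exists_spread_points hb h k
  have hlt : ∀ i j : ℕ, i < j → j ≤ k →
      (1 + p i) * (1 + p j) * ((j : ℝ) - i) * (b / (128 * (k + 1))) ≤ p j - p i := by
    intro i j hij hj
    have hi0 := (hp i (by lia)).1
    have hj0 := (hp j hj).1
    obtain ⟨hle, hmeas⟩ := hpp i j hij hj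
    have h1 := hmeas.trans (measureReal_Ioc_le hν hi0 hle)
    have h2 : 1 / (1 + p i) - 1 / (1 + p j) = (p j - p i) / ((1 + p i) * (1 + p j)) := by
      field_simp; ring
    rw [h2, mul_div_assoc' 64 (p j - p i), le_div_iff₀ (by positivity)] at h1
    have h3 : b / (128 * ((k : ℝ) + 1)) = b / (2 * k + 2) / 64 := by
      rw [div_div]; congr 1; ring
    rw [h3]
    linarith
  have h4 : 4 / (b / (128 * ((k : ℝ) + 1))) = 512 * (k + 1) / b := by
    field_simp; norm_num
  rw [← h4]
  refine P.abs_eval_le_of_spread_nodes hP (fun i hi => (hp i hi).1) hε (by positivity)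
    (fun i hi => (hp i hi).2) (fun i hi j hj => ?_) x
  rcases lt_trichotomy i j with hij | rfl | hij
  · have hij' : (i : ℝ) < j := by exact_mod_cast hij
    rw [abs_sub_comm, abs_of_pos (sub_pos.2 hij'), abs_sub_comm]
    exact (hlt i j hij hj).trans (le_abs_self _)
  · simp
  · have hij' : (j : ℝ) < i := by exact_mod_cast hij
    rw [abs_of_pos (sub_pos.2 hij')]
    refine le_trans (le_of_eq ?_) ((hlt j i hij hi).trans (le_abs_self _))
    ring

theorem Polynomial.abs_eval_le_of_measure {ν : Measure ℝ} [IsFiniteMeasure ν]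
    (hν : ν ≤ volume.withDensity expDensity) {P : Polynomial ℝ} {k : ℕ} (hP : P.natDegree ≤ k)
    {ε a : ℝ} (hε : 0 ≤ ε) (ha : 0 < a) (h : a ≤ ν.real {x | |P.eval x| ≤ ε}) (x : ℝ) :
    |P.eval x| ≤ ε * (1024 * (k + 1) / a) ^ k * Real.exp ((1 + |x|) / 2) := by
  have := nullSingletonClass_of_le_withDensity hν
  have hclosed : MeasurableSet {x | |P.eval x| ≤ ε} :=
    (isClosed_le P.continuous.abs continuous_const).measurableSet
  have h12 : 512 * ((k : ℝ) + 1) / (a / 2) = 1024 * (k + 1) / a := by field_simp; norm_num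
  rw [← h12]
  by_cases hcase : a / 2 ≤ ν.real ({x | |P.eval x| ≤ ε} ∩ Set.Ioi 0)
  · exact P.abs_eval_le_of_measure_Ioi hν hP hε (by positivity) hcase x
  · have hneg : a / 2 ≤ ν.real ({x | |P.eval x| ≤ ε} ∩ Set.Iio 0) := by
      have hsub : {x | |P.eval x| ≤ ε} ⊆ ({x | |P.eval x| ≤ ε} ∩ Set.Ioi 0) ∪
          ({x | |P.eval x| ≤ ε} ∩ Set.Iio 0) ∪ {0} := by
        intro y hy
        rcases lt_trichotomy y 0 with h | h | h
        · exact Or.inl (Or.inr ⟨hy, h⟩)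
        · exact Or.inr h
        · exact Or.inl (Or.inl ⟨hy, h⟩)
      have h1 := (measureReal_mono hsub).trans (measureReal_union_le (μ := ν) _ _)
      have h2 := measureReal_union_le (μ := ν) ({x | |P.eval x| ≤ ε} ∩ Set.Ioi 0)
        ({x | |P.eval x| ≤ ε} ∩ Set.Iio 0)
      have h3 : ν.real {0} = 0 := by simp [measureReal_def]
      linarith
    have hν' : ν.map (fun x => -x) ≤ volume.withDensity expDensity := by
      refine Measure.le_iff.2 fun s hs => ?_
      rw [Measure.map_apply measurable_neg hs, withDensity_apply _ hs]
      refine (hν _).trans ?_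
      rw [withDensity_apply _ (measurable_neg hs), ← (Measure.measurePreserving_neg
        (volume : Measure ℝ)).setLIntegral_comp_preimage hs (by fun_prop)]
      simp [expDensity]
    have hneg' : a / 2 ≤ (ν.map (fun x => -x)).real
        ({x | |(P.comp (-Polynomial.X)).eval x| ≤ ε} ∩ Set.Ioi 0) := by
      rw [map_measureReal_apply measurable_neg]
      · refine hneg.trans (measureReal_mono fun y hy => ?_)
        exact ⟨by simpa using hy.1, by simpa using hy.2⟩
      · exact ((isClosed_le (Polynomial.continuous _).abs continuous_const).measurableSet).inter
          measurableSet_Ioi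
    have hdeg : (P.comp (-Polynomial.X)).natDegree ≤ k := by
      rw [Polynomial.natDegree_comp]; simpa using hP
    simpa using Polynomial.abs_eval_le_of_measure_Ioi hν' hdeg hε (by positivity) hneg' (-x)

/-- A polynomial that is small on a set of measure `a` has small mean absolute value. -/
theorem Polynomial.lintegral_abs_eval_le_of_measure {ν : Measure ℝ} [IsFiniteMeasure ν]
    (hν : ν ≤ volume.withDensity expDensity) {P : Polynomial ℝ} {k : ℕ} (hk : 1 ≤ k)
    (hP : P.natDegree ≤ k) {ε a : ℝ} (hε : 0 ≤ ε) (ha : 0 < a)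
    (h : a ≤ ν.real {x | |P.eval x| ≤ ε}) :
    ∫⁻ x, ENNReal.ofReal |P.eval x| ∂ν ≤ ENNReal.ofReal (ε * (524288 * k / a) ^ k) := by
  have hk' : (1 : ℝ) ≤ k := by exact_mod_cast hk
  have hm1 : Measurable fun x : ℝ => ENNReal.ofReal |P.eval x| :=
    (P.continuous.abs.measurable).ennreal_ofReal
  calc ∫⁻ x, ENNReal.ofReal |P.eval x| ∂ν
      ≤ ∫⁻ x, ENNReal.ofReal |P.eval x| ∂volume.withDensity expDensity :=
        lintegral_mono' hν le_rfl
    _ = ∫⁻ x, expDensity x * ENNReal.ofReal |P.eval x| :=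
        lintegral_withDensity_eq_lintegral_mul _ (by fun_prop) hm1
    _ ≤ ∫⁻ x, ENNReal.ofReal (64 * (ε * (2048 * k / a) ^ k)) *
          ENNReal.ofReal (Real.exp (-|x| / 2)) := by
        refine lintegral_mono fun x => ?_
        rw [← ENNReal.ofReal_mul (by positivity), ← ENNReal.ofReal_mul (by positivity)]
        refine ENNReal.ofReal_le_ofReal ?_
        have h1 : |P.eval x| ≤ ε * (2048 * k / a) ^ k * Real.exp ((1 + |x|) / 2) := by
          refine (P.abs_eval_le_of_measure hν hP hε ha h x).trans ?_
          have h3 : 1024 * ((k : ℝ) + 1) ≤ 2048 * k := by linarith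
          gcongr
        have h2 : Real.exp (1 / 2) ≤ 2 := by
          have h3 := Real.exp_one_lt_d9
          have h4 : Real.exp (1 / 2) ^ 2 = Real.exp 1 := by
            rw [← Real.exp_nat_mul]; norm_num
          nlinarith [Real.exp_pos (1 / 2)]
        calc 32 * Real.exp (-|x|) * |P.eval x|
            ≤ 32 * Real.exp (-|x|) * (ε * (2048 * k / a) ^ k * Real.exp ((1 + |x|) / 2)) := by
              gcongr
          _ = 32 * (ε * (2048 * k / a) ^ k) * Real.exp (1 / 2) * Real.exp (-|x| / 2) := by
              have h3 : Real.exp (-|x|) * Real.exp ((1 + |x|) / 2) =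
                  Real.exp (1 / 2) * Real.exp (-|x| / 2) := by
                rw [← Real.exp_add, ← Real.exp_add]; ring_nf
              linear_combination 32 * (ε * (2048 * k / a) ^ k) * h3
          _ ≤ 32 * (ε * (2048 * k / a) ^ k) * 2 * Real.exp (-|x| / 2) := by gcongr
          _ = _ := by ring
    _ = ENNReal.ofReal (64 * (ε * (2048 * k / a) ^ k)) * ENNReal.ofReal 4 := by
        rw [lintegral_const_mul _ (by fun_prop), lintegral_exp_neg_abs_half]
    _ = ENNReal.ofReal (ε * (2048 * k / a) ^ k * 256) := by
        rw [← ENNReal.ofReal_mul (by positivity)]; congr 1; ring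
    _ ≤ ENNReal.ofReal (ε * (2048 * k / a) ^ k * 256 ^ k) := by
        refine ENNReal.ofReal_le_ofReal ?_
        gcongr
        exact le_self_pow₀ (by norm_num) (by lia)
    _ = _ := by
        rw [mul_assoc, ← mul_pow]; congr 3; ring

theorem lintegral_sliceDensity {n : ℕ} (i : Fin (n + 1)) {K : Set (Fin (n + 1) → ℝ)}
    (hK : MeasurableSet K) : ∫⁻ t, sliceDensity i K t = gaussianPi (n + 1) K := by
  simpa using (gaussianPi_inter_preimage i hK MeasurableSet.univ).symm

/-- After an affine normalization, the one-dimensional marginals of the Gaussian measure conditioned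
on a convex set are dominated by `expDensity`. -/
theorem exists_marginal_le_expDensity {n : ℕ} (i : Fin (n + 1)) {K : Set (Fin (n + 1) → ℝ)}
    (hK : MeasurableSet K) (hc : Convex ℝ K) (hpos : gaussianPi (n + 1) K ≠ 0) :
    ∃ c T : ℝ, 0 < T ∧ (gaussianPi (n + 1) K)⁻¹ •
      ((gaussianPi (n + 1)).restrict K).map (fun z => T⁻¹ * (z i - c)) ≤
        volume.withDensity expDensity := by
  set G := gaussianPi (n + 1) K with hG
  have hGtop : G ≠ ∞ := measure_ne_top _ _
  have hGinv : G⁻¹ ≠ ∞ := ENNReal.inv_ne_top.2 hpos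
  set w : ℝ → ℝ := fun t => (G⁻¹ * sliceDensity i K t).toReal with hw
  have htop : ∀ t, G⁻¹ * sliceDensity i K t ≠ ∞ := fun t =>
    ENNReal.mul_ne_top hGinv (ne_top_of_le_ne_top ENNReal.one_ne_top (sliceDensity_le_one i K t))
  have hofReal : ∀ t, ENNReal.ofReal (w t) = G⁻¹ * sliceDensity i K t := fun t =>
    ENNReal.ofReal_toReal (htop t)
  have hbdd : BddAbove (Set.range w) := by
    refine ⟨G⁻¹.toReal, ?_⟩
    rintro _ ⟨t, rfl⟩
    exact ENNReal.toReal_mono hGinv (mul_le_of_le_one_right' (sliceDensity_le_one i K t))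
  have hlog : ∀ ⦃r s : ℝ⦄, 0 < r → 0 < s → r + s = 1 → ∀ t u,
      w t ^ r * w u ^ s ≤ w (r * t + s * u) := by
    intro r s hr hs hrs t u
    simp only [hw]
    rw [ENNReal.toReal_rpow, ENNReal.toReal_rpow, ← ENNReal.toReal_mul]
    refine ENNReal.toReal_mono (htop _) ?_
    rw [ENNReal.mul_rpow_of_nonneg _ _ hr.le, ENNReal.mul_rpow_of_nonneg _ _ hs.le]
    calc _ = (G⁻¹ ^ r * G⁻¹ ^ s) * (sliceDensity i K t ^ r * sliceDensity i K u ^ s) := by ring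
      _ = G⁻¹ * (sliceDensity i K t ^ r * sliceDensity i K u ^ s) := by
        rw [← ENNReal.rpow_add _ _ (ENNReal.inv_ne_zero.2 hGtop) hGinv, hrs, ENNReal.rpow_one]
      _ ≤ _ := by
        gcongr
        exact sliceDensity_geom_mean_le i hK hc hr hs hrs t u
  have hone : ∫⁻ t, ENNReal.ofReal (w t) = 1 := by
    simp_rw [hofReal]
    rw [lintegral_const_mul _ (measurable_sliceDensity i hK), lintegral_sliceDensity i hK,
      ENNReal.inv_mul_cancel hpos hGtop]
  obtain ⟨c, T, hT, hdecay⟩ :=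
    exists_exp_decay_of_logConcave (fun _ => ENNReal.toReal_nonneg) hbdd hlog hone
  refine ⟨c, T, hT, Measure.le_iff.2 fun S hS => ?_⟩
  set g : ℝ → ℝ := fun t => T⁻¹ * (t - c) with hg
  have hgm : Measurable g := by fun_prop
  have hgc : ∀ t, c + T * g t = t := fun t => by simp only [hg]; field_simp; ring
  have hgi : Measurable fun z : Fin (n + 1) → ℝ => g (z i) := hgm.comp (measurable_pi_apply i)
  have hmap : (volume : Measure ℝ).map g = ENNReal.ofReal T • volume := by
    have h1 : (volume : Measure ℝ).map (fun t => t - c) = volume :=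
      (measurePreserving_sub_right volume c).map_eq
    have h2 := Real.map_volume_mul_left (inv_pos.2 hT).ne'
    rw [inv_inv, abs_of_pos hT] at h2
    rw [← h2]
    nth_rw 2 [← h1]
    rw [Measure.map_map (by fun_prop) (by fun_prop)]
    rfl
  calc (G⁻¹ • ((gaussianPi (n + 1)).restrict K).map (fun z => g (z i))) S
      = G⁻¹ * gaussianPi (n + 1) (K ∩ {z | z i ∈ g ⁻¹' S}) := by
        rw [Measure.smul_apply, smul_eq_mul, Measure.map_apply hgi hS,
          Measure.restrict_apply (hgi hS), Set.inter_comm]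
        rfl
    _ = ∫⁻ t in g ⁻¹' S, ENNReal.ofReal (w t) := by
        simp_rw [hofReal]
        rw [gaussianPi_inter_preimage i hK (hgm hS),
          lintegral_const_mul _ (measurable_sliceDensity i hK)]
    _ ≤ ∫⁻ t in g ⁻¹' S, ENNReal.ofReal T⁻¹ * expDensity (g t) := by
        refine lintegral_mono fun t => ?_
        rw [← ENNReal.ofReal_mul (inv_pos.2 hT).le]
        refine ENNReal.ofReal_le_ofReal ?_
        have := hdecay (g t)
        rw [hgc] at this
        rw [← div_eq_inv_mul, le_div_iff₀ hT]
        linarith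
    _ = ENNReal.ofReal T⁻¹ * ∫⁻ t in S, expDensity t ∂(volume.map g) := by
        rw [lintegral_const_mul _ (by fun_prop), setLIntegral_map hS (by fun_prop) hgm]
    _ = ∫⁻ t in S, expDensity t := by
        rw [hmap, setLIntegral_smul_measure, smul_eq_mul, ← mul_assoc,
          ← ENNReal.ofReal_mul (inv_pos.2 hT).le, inv_mul_cancel₀ hT.ne', ENNReal.ofReal_one,
          one_mul]
    _ = _ := (withDensity_apply _ hS).symm

/-- The one-dimensional estimate for polynomials in one coordinate over a convex body. -/
theorem setLIntegral_abs_eval_coord_le {n : ℕ} (i : Fin (n + 1)) {K : Set (Fin (n + 1) → ℝ)}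
    (hK : MeasurableSet K) (hc : Convex ℝ K) {P : Polynomial ℝ} {k : ℕ} (hk : 1 ≤ k)
    (hP : P.natDegree ≤ k) {ε a : ℝ} (hε : 0 ≤ ε) (ha : 0 < a)
    (h : a * (gaussianPi (n + 1)).real K ≤
      (gaussianPi (n + 1)).real (K ∩ {z | |P.eval (z i)| ≤ ε})) :
    ∫⁻ z in K, ENNReal.ofReal |P.eval (z i)| ∂gaussianPi (n + 1) ≤
      ENNReal.ofReal (ε * (524288 * k / a) ^ k) * gaussianPi (n + 1) K := by
  by_cases hpos : gaussianPi (n + 1) K = 0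
  · rw [Measure.restrict_eq_zero.2 hpos]; simp
  obtain ⟨c, T, hT, hν⟩ := exists_marginal_le_expDensity i hK hc hpos
  set G := gaussianPi (n + 1) K with hG
  have hGtop : G ≠ ∞ := measure_ne_top _ _
  have hg : Measurable fun z : Fin (n + 1) → ℝ => T⁻¹ * (z i - c) := by fun_prop
  set Q : Polynomial ℝ := P.comp (Polynomial.C c + Polynomial.C T * Polynomial.X) with hQ
  have hQe : ∀ t, Q.eval (T⁻¹ * (t - c)) = P.eval t := fun t => by
    simp only [hQ, Polynomial.eval_comp, Polynomial.eval_add, Polynomial.eval_C,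
      Polynomial.eval_mul, Polynomial.eval_X]
    congr 1; field_simp; ring
  have hQd : Q.natDegree ≤ k := by
    refine Polynomial.natDegree_comp_le.trans (le_trans ?_ hP)
    refine mul_le_of_le_one_right' ?_
    rw [add_comm]
    exact Polynomial.natDegree_linear_le
  set ν := G⁻¹ • ((gaussianPi (n + 1)).restrict K).map (fun z => T⁻¹ * (z i - c)) with hνdef
  have : IsFiniteMeasure ν := ⟨by
    rw [hνdef, Measure.smul_apply, smul_eq_mul]
    exact ENNReal.mul_lt_top (ENNReal.inv_lt_top.2 (pos_iff_ne_zero.2 hpos)) (measure_lt_top _ _)⟩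
  have hmeas : MeasurableSet {x : ℝ | |Q.eval x| ≤ ε} :=
    (isClosed_le Q.continuous.abs continuous_const).measurableSet
  have hνB : a ≤ ν.real {x | |Q.eval x| ≤ ε} := by
    rw [measureReal_def, hνdef, Measure.smul_apply, smul_eq_mul, Measure.map_apply hg hmeas,
      Measure.restrict_apply (hg hmeas), ENNReal.toReal_mul, ENNReal.toReal_inv, inv_mul_eq_div,
      le_div_iff₀ (ENNReal.toReal_pos hpos hGtop)]
    refine h.trans (le_of_eq ?_)
    rw [measureReal_def, Set.inter_comm]
    simp [Set.preimage, hQe]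
  have key := Q.lintegral_abs_eval_le_of_measure hν hk hQd hε ha hνB
  rw [hνdef, lintegral_smul_measure, smul_eq_mul, lintegral_map
    (Q.continuous.abs.measurable.ennreal_ofReal) hg] at key
  simp_rw [hQe] at key
  rw [mul_comm G⁻¹, ← div_eq_mul_inv] at key
  exact (ENNReal.div_le_iff hpos hGtop).1 key

theorem gaussianPi_hyperplane {n : ℕ} {i j : Fin n} (hij : i ≠ j) (α β : ℝ) {a b : ℝ}
    (hab : a ≠ 0 ∨ b ≠ 0) : gaussianPi n {z | a * (z i - α) + b * (z j - β) = 0} = 0 := by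
  wlog ha : a ≠ 0 generalizing i j α β a b
  · have := this hij.symm β α hab.symm (hab.resolve_left ha)
    simpa only [add_comm] using this
  obtain _ | n := n
  · exact i.elim0
  have hmeas : MeasurableSet {z : Fin (n + 1) → ℝ | a * (z i - α) + b * (z j - β) = 0} :=
    measurableSet_eq_fun (by fun_prop) (by fun_prop)
  have hpres := (measurePreserving_piFinSuccAbove
    (fun _ : Fin (n + 1) => gaussianReal 0 1) i).symm
  rw [← hpres.measure_preimage hmeas.nullMeasurableSet,
    Measure.prod_apply_symm (hpres.measurable hmeas)]
  refine (lintegral_congr fun y => ?_).trans lintegral_zero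
  obtain ⟨l, rfl⟩ := Fin.exists_succAbove_eq hij.symm
  refine measure_mono_null (t := {α - b * (y l - β) / a}) (fun t ht => ?_) ?_
  · have ht' : a * (t - α) + b * (y l - β) = 0 := by
      have h : a * ((i.insertNth t y : Fin (n + 1) → ℝ) i - α) +
        b * ((i.insertNth t y : Fin (n + 1) → ℝ) (i.succAbove l) - β) = 0 := ht
      simpa using h
    rw [Set.mem_singleton_iff, eq_sub_iff_add_eq, ← eq_sub_iff_add_eq', div_eq_iff ha]
    linarith
  · have := nullSingletonClass_gaussianReal (μ := 0) (v := 1) one_ne_zero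
    exact measure_singleton _

/-- Bisection: among the half-planes through a point there is one on which two integrable functions
with positive integrals both keep a positive integral. -/
theorem exists_halfplane_setIntegral_pos {X : Type*} [MeasurableSpace X] {μ : Measure X}
    {u v : X → ℝ} (hu : Measurable u) (hv : Measurable v)
    (hnull : ∀ a b : ℝ, a ≠ 0 ∨ b ≠ 0 → μ {x | a * u x + b * v x = 0} = 0)
    {f g : X → ℝ} (hf : Integrable f μ) (hg : Integrable g μ)
    (hfpos : 0 < ∫ x, f x ∂μ) (hgpos : 0 < ∫ x, g x ∂μ) :
    ∃ a b : ℝ, (a ≠ 0 ∨ b ≠ 0) ∧ 0 < ∫ x in {x | 0 ≤ a * u x + b * v x}, f x ∂μ ∧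
      0 < ∫ x in {x | 0 ≤ a * u x + b * v x}, g x ∂μ := by
  set H : ℝ → Set X := fun θ => {x | 0 ≤ Real.cos θ * u x + Real.sin θ * v x} with hH
  have hHm : ∀ θ, MeasurableSet (H θ) := fun θ => measurableSet_le (by fun_prop) (by fun_prop)
  have hne : ∀ θ : ℝ, Real.cos θ ≠ 0 ∨ Real.sin θ ≠ 0 := fun θ => by
    by_contra! h
    have := Real.sin_sq_add_cos_sq θ
    rw [h.1, h.2] at this
    norm_num at this
  have hcompl : ∀ θ, H (θ + Real.pi) =ᵐ[μ] ((H θ)ᶜ : Set X) := by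
    intro θ
    have h0 : ∀ᵐ x ∂μ, Real.cos θ * u x + Real.sin θ * v x ≠ 0 := by
      rw [ae_iff]
      simpa using hnull _ _ (hne θ)
    filter_upwards [h0] with x hx
    refine propext ⟨fun h h' => ?_, fun h => ?_⟩
    · change 0 ≤ Real.cos (θ + Real.pi) * u x + Real.sin (θ + Real.pi) * v x at h
      change 0 ≤ Real.cos θ * u x + Real.sin θ * v x at h'
      rw [Real.cos_add_pi, Real.sin_add_pi] at h
      exact hx (le_antisymm (by linarith) h')
    · have h' : ¬ 0 ≤ Real.cos θ * u x + Real.sin θ * v x := h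
      change 0 ≤ Real.cos (θ + Real.pi) * u x + Real.sin (θ + Real.pi) * v x
      rw [Real.cos_add_pi, Real.sin_add_pi]
      linarith
  have hsum : ∀ {k : X → ℝ}, Integrable k μ → ∀ θ,
      ∫ x in H θ, k x ∂μ + ∫ x in H (θ + Real.pi), k x ∂μ = ∫ x, k x ∂μ := by
    intro k hk θ
    rw [setIntegral_congr_set (hcompl θ), integral_add_compl (hHm θ) hk]
  have hcont : Continuous fun θ => ∫ x in H θ, f x ∂μ := by
    simp_rw [← integral_indicator (hHm _)]
    refine continuous_iff_continuousAt.2 fun θ₀ => ?_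
    refine continuousAt_of_dominated (bound := fun x => ‖f x‖)
      (Eventually.of_forall fun θ => (hf.indicator (hHm θ)).aestronglyMeasurable)
      (Eventually.of_forall fun θ => Eventually.of_forall fun x => norm_indicator_le_norm_self _ _)
      hf.norm ?_
    have h0 : ∀ᵐ x ∂μ, Real.cos θ₀ * u x + Real.sin θ₀ * v x ≠ 0 := by
      rw [ae_iff]
      simpa using hnull _ _ (hne θ₀)
    filter_upwards [h0] with x hx
    have hc : Continuous fun θ => Real.cos θ * u x + Real.sin θ * v x := by fun_prop
    rcases lt_or_gt_of_ne hx with hlt | hgt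
    · refine ContinuousAt.congr (f := fun _ => (0 : ℝ)) continuousAt_const ?_
      filter_upwards [hc.continuousAt.eventually_lt_const hlt] with θ hθ
      exact (Set.indicator_of_notMem (fun h : x ∈ H θ => not_le.2 hθ h) _).symm
    · refine ContinuousAt.congr (f := fun _ => f x) continuousAt_const ?_
      filter_upwards [hc.continuousAt.eventually_const_lt hgt] with θ hθ
      exact (Set.indicator_of_mem (show x ∈ H θ from hθ.le) _).symm
  have hhalf : ∃ θ, ∫ x in H θ, f x ∂μ = (∫ x, f x ∂μ) / 2 := by
    have h1 := hsum hf 0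
    rw [zero_add] at h1
    have h2 : (∫ x, f x ∂μ) / 2 ∈ Set.uIcc (∫ x in H 0, f x ∂μ) (∫ x in H Real.pi, f x ∂μ) := by
      rw [← h1, Set.mem_uIcc]
      rcases le_total (∫ x in H 0, f x ∂μ) (∫ x in H Real.pi, f x ∂μ) with h | h
      · left; constructor <;> linarith
      · right; constructor <;> linarith
    obtain ⟨θ, -, hθ⟩ := intermediate_value_uIcc (a := 0) (b := Real.pi) hcont.continuousOn h2
    exact ⟨θ, hθ⟩
  obtain ⟨θ, hθ⟩ := hhalf
  have h1 := hsum hf θ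
  have h2 := hsum hg θ
  by_cases h : 0 < ∫ x in H θ, g x ∂μ
  · exact ⟨Real.cos θ, Real.sin θ, hne θ, by rw [hθ]; linarith, h⟩
  · exact ⟨Real.cos (θ + Real.pi), Real.sin (θ + Real.pi), hne _, by linarith, by linarith⟩

/-- Points whose coordinate projections are supported at every rational point are collinear. -/
theorem collinear_of_rational_halfplanes {S : Set (ℝ × ℝ)}
    (hS : ∀ α β : ℚ, ∃ a b : ℝ, (a ≠ 0 ∨ b ≠ 0) ∧
      ∀ z ∈ S, 0 ≤ a * (z.1 - α) + b * (z.2 - β))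
    {x y z : ℝ × ℝ} (hx : x ∈ S) (hy : y ∈ S) (hz : z ∈ S) :
    (y.1 - x.1) * (z.2 - x.2) = (y.2 - x.2) * (z.1 - x.1) := by
  by_contra hne
  set D := (y.1 - x.1) * (z.2 - x.2) - (y.2 - x.2) * (z.1 - x.1) with hDdef
  have hD : D ≠ 0 := sub_ne_zero.2 hne
  set s : ℝ × ℝ → ℝ := fun q => ((q.1 - x.1) * (z.2 - x.2) - (q.2 - x.2) * (z.1 - x.1)) / D with hs
  set t : ℝ × ℝ → ℝ := fun q => ((y.1 - x.1) * (q.2 - x.2) - (y.2 - x.2) * (q.1 - x.1)) / D with ht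
  have hsc : Continuous s := by fun_prop
  have htc : Continuous t := by fun_prop
  have hopen : IsOpen ({q | 0 < s q} ∩ ({q | 0 < t q} ∩ {q | s q + t q < 1})) :=
    (isOpen_lt continuous_const hsc).inter
      ((isOpen_lt continuous_const htc).inter (isOpen_lt (hsc.add htc) continuous_const))
  have hnon : ({q | 0 < s q} ∩ ({q | 0 < t q} ∩ {q | s q + t q < 1})).Nonempty := by
    refine ⟨((x.1 + y.1 + z.1) / 3, (x.2 + y.2 + z.2) / 3), ?_⟩
    have h1 : s ((x.1 + y.1 + z.1) / 3, (x.2 + y.2 + z.2) / 3) = 1 / 3 := by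
      simp only [hs]; rw [div_eq_iff hD, hDdef]; ring
    have h2 : t ((x.1 + y.1 + z.1) / 3, (x.2 + y.2 + z.2) / 3) = 1 / 3 := by
      simp only [ht]; rw [div_eq_iff hD, hDdef]; ring
    change 0 < s _ ∧ 0 < t _ ∧ s _ + t _ < 1
    rw [h1, h2]; norm_num
  have hdense : DenseRange (Prod.map ((↑) : ℚ → ℝ) ((↑) : ℚ → ℝ)) :=
    Rat.denseRange_cast.prodMap Rat.denseRange_cast
  obtain ⟨⟨α, β⟩, h1, h2, h3⟩ := hdense.exists_mem_open hopen hnon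
  change 0 < s (α, β) at h1
  change 0 < t (α, β) at h2
  change s (α, β) + t (α, β) < 1 at h3
  set σ := s (α, β) with hσ
  set τ := t (α, β) with hτ
  have hα : (α : ℝ) = x.1 + σ * (y.1 - x.1) + τ * (z.1 - x.1) := by
    simp only [hσ, hτ, hs, ht]; field_simp; rw [hDdef]; ring
  have hβ : (β : ℝ) = x.2 + σ * (y.2 - x.2) + τ * (z.2 - x.2) := by
    simp only [hσ, hτ, hs, ht]; field_simp; rw [hDdef]; ring
  obtain ⟨a, b, hab, hsupp⟩ := hS α β
  have hLx := hsupp x hx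
  have hLy := hsupp y hy
  have hLz := hsupp z hz
  have hcomb : (1 - σ - τ) * (a * (x.1 - α) + b * (x.2 - β)) + σ * (a * (y.1 - α) + b * (y.2 - β)) +
      τ * (a * (z.1 - α) + b * (z.2 - β)) = 0 := by
    rw [hα, hβ]; ring
  have hρ : 0 < 1 - σ - τ := by linarith
  have px := mul_nonneg hρ.le hLx
  have py := mul_nonneg h1.le hLy
  have pz := mul_nonneg h2.le hLz
  have ex : a * (x.1 - α) + b * (x.2 - β) = 0 :=
    (mul_eq_zero.1 (show (1 - σ - τ) * _ = 0 by linarith)).resolve_left hρ.ne'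
  have ey : a * (y.1 - α) + b * (y.2 - β) = 0 :=
    (mul_eq_zero.1 (show σ * _ = 0 by linarith)).resolve_left h1.ne'
  have ez : a * (z.1 - α) + b * (z.2 - β) = 0 :=
    (mul_eq_zero.1 (show τ * _ = 0 by linarith)).resolve_left h2.ne'
  have e1 : a * (y.1 - x.1) + b * (y.2 - x.2) = 0 := by linarith
  have e2 : a * (z.1 - x.1) + b * (z.2 - x.2) = 0 := by linarith
  have haD : a * D = 0 := by rw [hDdef]; linear_combination (z.2 - x.2) * e1 - (y.2 - x.2) * e2
  have hbD : b * D = 0 := by rw [hDdef]; linear_combination (y.1 - x.1) * e2 - (z.1 - x.1) * e1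
  rcases hab with h | h
  · exact h ((mul_eq_zero.1 haD).resolve_right hD)
  · exact h ((mul_eq_zero.1 hbD).resolve_right hD)

theorem exists_convex_refinement {n : ℕ} {f g : (Fin n → ℝ) → ℝ}
    (hf : Integrable f (gaussianPi n)) (hg : Integrable g (gaussianPi n)) {K : Set (Fin n → ℝ)}
    (hK : IsCompact K) (hKc : Convex ℝ K) (hKf : 0 < ∫ z in K, f z ∂gaussianPi n)
    (hKg : 0 < ∫ z in K, g z ∂gaussianPi n) {i j : Fin n} (hij : i ≠ j) (α β : ℝ) :
    ∃ a b : ℝ, (a ≠ 0 ∨ b ≠ 0) ∧ ∃ K' ⊆ K, (∀ z ∈ K', 0 ≤ a * (z i - α) + b * (z j - β)) ∧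
      IsCompact K' ∧ Convex ℝ K' ∧ 0 < ∫ z in K', f z ∂gaussianPi n ∧
      0 < ∫ z in K', g z ∂gaussianPi n := by
  obtain ⟨a, b, hab, h1, h2⟩ := exists_halfplane_setIntegral_pos
    (μ := (gaussianPi n).restrict K) (u := fun z => z i - α) (v := fun z => z j - β)
    (by fun_prop) (by fun_prop)
    (fun a b hab => Measure.absolutelyContinuous_of_le Measure.restrict_le_self
      (gaussianPi_hyperplane hij α β hab)) hf.restrict hg.restrict hKf hKg
  set H : Set (Fin n → ℝ) := {z | 0 ≤ a * (z i - α) + b * (z j - β)} with hH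
  have hclosed : IsClosed H := isClosed_le continuous_const (by fun_prop)
  rw [Measure.restrict_restrict hclosed.measurableSet] at h1 h2
  refine ⟨a, b, hab, H ∩ K, Set.inter_subset_right, fun z hz => hz.1, hK.inter_left hclosed,
    Convex.inter ?_ hKc, h1, h2⟩
  intro z hz w hw r s hr hs hrs
  change 0 ≤ a * ((r • z + s • w) i - α) + b * ((r • z + s • w) j - β)
  change 0 ≤ a * (z i - α) + b * (z j - β) at hz
  change 0 ≤ a * (w i - α) + b * (w j - β) at hw
  simp only [Pi.add_apply, Pi.smul_apply, smul_eq_mul]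
  obtain rfl : r = 1 - s := by linarith
  nlinarith [mul_nonneg hr hz, mul_nonneg hs hw]

theorem exists_closedBall_setIntegral_pos {n : ℕ} {f g : (Fin n → ℝ) → ℝ}
    (hf : Integrable f (gaussianPi n)) (hg : Integrable g (gaussianPi n))
    (hfpos : 0 < ∫ z, f z ∂gaussianPi n) (hgpos : 0 < ∫ z, g z ∂gaussianPi n) :
    ∃ R : ℝ, 0 < ∫ z in Metric.closedBall 0 R, f z ∂gaussianPi n ∧
      0 < ∫ z in Metric.closedBall 0 R, g z ∂gaussianPi n := by
  have hlim : ∀ {h : (Fin n → ℝ) → ℝ}, Integrable h (gaussianPi n) →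
      Tendsto (fun R : ℕ => ∫ z in Metric.closedBall 0 (R : ℝ), h z ∂gaussianPi n) atTop
        (nhds (∫ z, h z ∂gaussianPi n)) := by
    intro h hh
    have := tendsto_setIntegral_of_monotone (μ := gaussianPi n)
      (s := fun R : ℕ => Metric.closedBall (0 : Fin n → ℝ) R)
      (fun R => Metric.isClosed_closedBall.measurableSet)
      (fun R R' hR => Metric.closedBall_subset_closedBall (Nat.cast_le.2 hR)) hh.integrableOn
    rwa [Metric.iUnion_closedBall_nat, setIntegral_univ] at this
  obtain ⟨R, h1, h2⟩ := (((hlim hf).eventually_const_lt hfpos).and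
    ((hlim hg).eventually_const_lt hgpos)).exists
  exact ⟨R, h1, h2⟩

/-- Localization: two positive integrals remain positive along a decreasing sequence of convex
bodies shrinking to a subset of a line. -/
theorem exists_needle {n : ℕ} [NeZero n] {f g : (Fin n → ℝ) → ℝ}
    (hf : Integrable f (gaussianPi n)) (hg : Integrable g (gaussianPi n))
    (hfpos : 0 < ∫ z, f z ∂gaussianPi n) (hgpos : 0 < ∫ z, g z ∂gaussianPi n) :
    ∃ K : ℕ → Set (Fin n → ℝ), Antitone K ∧
      (∀ m, IsCompact (K m) ∧ Convex ℝ (K m) ∧ 0 < ∫ z in K m, f z ∂gaussianPi n ∧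
        0 < ∫ z in K m, g z ∂gaussianPi n) ∧
      ∃ (i : Fin n) (x v : Fin n → ℝ), ∀ z ∈ ⋂ m, K m, ∀ j, z j = x j + (z i - x i) * v j := by
  obtain ⟨R, hRf, hRg⟩ := exists_closedBall_setIntegral_pos hf hg hfpos hgpos
  let Good : Set (Fin n → ℝ) → Prop := fun K => IsCompact K ∧ Convex ℝ K ∧
    0 < ∫ z in K, f z ∂gaussianPi n ∧ 0 < ∫ z in K, g z ∂gaussianPi n
  have hstep : ∀ (K : {K // Good K}) (q : Fin n × Fin n × ℚ × ℚ), ∃ K' : {K // Good K},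
      K'.1 ⊆ K.1 ∧ (q.1 ≠ q.2.1 → ∃ a b : ℝ, (a ≠ 0 ∨ b ≠ 0) ∧
        ∀ z ∈ K'.1, 0 ≤ a * (z q.1 - q.2.2.1) + b * (z q.2.1 - q.2.2.2)) := by
    rintro ⟨K, hK, hKc, hKf, hKg⟩ ⟨i, j, α, β⟩
    by_cases hij : i = j
    · exact ⟨⟨K, hK, hKc, hKf, hKg⟩, subset_rfl, fun h => absurd hij h⟩
    · obtain ⟨a, b, hab, K', hsub, hsupp, hgood⟩ :=
        exists_convex_refinement hf hg hK hKc hKf hKg hij α β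
      exact ⟨⟨K', hgood⟩, hsub, fun _ => ⟨a, b, hab, hsupp⟩⟩
  choose next hnext_sub hnext_supp using hstep
  have : Nonempty (Fin n) := ⟨0⟩
  obtain ⟨enum, henum⟩ := exists_surjective_nat (Fin n × Fin n × ℚ × ℚ)
  let K : ℕ → {K // Good K} := fun m => Nat.rec
    ⟨Metric.closedBall 0 R, isCompact_closedBall 0 R, convex_closedBall 0 R, hRf, hRg⟩
    (fun m K => next K (enum m)) m
  refine ⟨fun m => (K m).1, antitone_nat_of_succ_le fun m => hnext_sub (K m) (enum m),
    fun m => (K m).2, ?_⟩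
  have hminor : ∀ i j : Fin n, i ≠ j → ∀ x ∈ ⋂ m, (K m).1, ∀ y ∈ ⋂ m, (K m).1,
      ∀ z ∈ ⋂ m, (K m).1, (y i - x i) * (z j - x j) = (y j - x j) * (z i - x i) := by
    intro i j hij x hx y hy z hz
    refine collinear_of_rational_halfplanes
      (S := (fun z : Fin n → ℝ => (z i, z j)) '' ⋂ m, (K m).1) (fun α β => ?_)
      (Set.mem_image_of_mem _ hx) (Set.mem_image_of_mem _ hy) (Set.mem_image_of_mem _ hz)
    obtain ⟨m, hm⟩ := henum (i, j, α, β)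
    have h := hnext_supp (K m) (enum m)
    rw [hm] at h
    obtain ⟨a, b, hab, hsupp⟩ := h hij
    refine ⟨a, b, hab, ?_⟩
    rintro _ ⟨w, hw, rfl⟩
    have hw' := Set.mem_iInter.1 hw (m + 1)
    change w ∈ (next (K m) (enum m)).1 at hw'
    rw [hm] at hw'
    exact hsupp w hw'
  by_cases htriv : ∃ x ∈ ⋂ m, (K m).1, ∃ y ∈ ⋂ m, (K m).1, y ≠ x
  · obtain ⟨x, hx, y, hy, hne⟩ := htriv
    obtain ⟨i, hi⟩ := Function.ne_iff.1 hne
    have hi' : y i - x i ≠ 0 := sub_ne_zero.2 hi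
    refine ⟨i, x, fun j => (y j - x j) / (y i - x i), fun z hz j => ?_⟩
    beta_reduce
    by_cases hij : i = j
    · subst hij
      rw [div_self hi']; ring
    · have := hminor i j hij x hx y hy z hz
      field_simp
      linarith
  · push Not at htriv
    by_cases hne : (⋂ m, (K m).1).Nonempty
    · obtain ⟨x, hx⟩ := hne
      exact ⟨0, x, 0, fun z hz j => by rw [htriv x hx z hz]; simp⟩
    · exact ⟨0, 0, 0, fun z hz => absurd ⟨z, hz⟩ hne⟩

theorem integrable_eval_gaussianPi {n : ℕ} (p : MvPolynomial (Fin n) ℝ) :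
    Integrable (fun z => MvPolynomial.eval z p) (gaussianPi n) := by
  simp_rw [MvPolynomial.eval_eq']
  refine integrable_finsetSum _ fun d _ => Integrable.const_mul ?_ _
  refine Integrable.fintype_prod (f := fun i (x : ℝ) => x ^ d i) fun i => ?_
  exact integrable_pow_of_mem_interior_integrableExpSet (X := id) (by simp) (d i)

theorem MvPolynomial.measurable_eval {n : ℕ} (p : MvPolynomial (Fin n) ℝ) :
    Measurable fun z : Fin n → ℝ => MvPolynomial.eval z p :=
  (MvPolynomial.continuous_eval p).measurable

/-- The restriction of a polynomial to a line parametrized by the `i`-th coordinate. -/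
theorem MvPolynomial.exists_restrict_line {n k : ℕ} (p : MvPolynomial (Fin n) ℝ)
    (hp : p.totalDegree ≤ k) (x v : Fin n → ℝ) (s : ℝ) : ∃ P : Polynomial ℝ, P.natDegree ≤ k ∧
      ∀ t, P.eval t = MvPolynomial.eval (fun j => x j + (t - s) * v j) p := by
  have heval : ∀ (q : MvPolynomial (Fin n) ℝ) (t : ℝ), (MvPolynomial.aeval (fun j =>
      Polynomial.C (v j) * Polynomial.X + Polynomial.C (x j - s * v j)) q).eval t =
      MvPolynomial.eval (fun j => x j + (t - s) * v j) q := fun q t => by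
    induction q using MvPolynomial.induction_on with
    | C a => simp
    | add p q hp hq => simp only [map_add, Polynomial.eval_add, hp, hq]
    | mul_X p j hp =>
      simp only [map_mul, Polynomial.eval_mul, hp, MvPolynomial.aeval_X, MvPolynomial.eval_X,
        Polynomial.eval_add, Polynomial.eval_C, Polynomial.eval_X]
      ring
  refine ⟨_, ?_, heval p⟩
  simpa using MvPolynomial.aeval_natDegree_le p hp _
    fun j => Polynomial.natDegree_linear_le (a := v j) (b := x j - s * v j)

theorem mean_le_of_measure_abs_le {n k : ℕ} (hk : 1 ≤ k) (p : MvPolynomial (Fin (n + 1)) ℝ)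
    (hp : p.totalDegree ≤ k) {ε a m κ : ℝ} (hε : 0 ≤ ε) (ha : 0 < a) (hκ : 0 < κ)
    (hmean : m < ∫ z, MvPolynomial.eval z p ∂gaussianPi (n + 1))
    (hmeas : a < (gaussianPi (n + 1)).real {z | |MvPolynomial.eval z p| ≤ ε}) :
    m ≤ (ε + κ) * (524288 * k / a) ^ k + κ := by
  set μ := gaussianPi (n + 1) with hμ
  set F : Set (Fin (n + 1) → ℝ) := {z | |MvPolynomial.eval z p| ≤ ε} with hF
  have hFm : MeasurableSet F := measurableSet_le p.measurable_eval.norm measurable_const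
  have hpi : Integrable (fun z => MvPolynomial.eval z p) μ := integrable_eval_gaussianPi p
  have hFi : Integrable (F.indicator (1 : (Fin (n + 1) → ℝ) → ℝ)) μ :=
    (integrable_const (1 : ℝ)).indicator hFm
  obtain ⟨K, hanti, hK, i, x, v, hline⟩ := exists_needle
    (f := fun z => MvPolynomial.eval z p - m) (g := fun z => F.indicator 1 z - a)
    (hpi.sub (integrable_const _)) (hFi.sub (integrable_const _))
    (by rw [integral_sub hpi (integrable_const _)]; simpa using hmean)
    (by rw [integral_sub hFi (integrable_const _), integral_indicator_one hFm]; simpa using hmeas)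
  obtain ⟨P, hPd, hPe⟩ := p.exists_restrict_line hp x v (x i)
  set V : Set (Fin (n + 1) → ℝ) := {z | |MvPolynomial.eval z p - P.eval (z i)| < κ} with hV
  have hVo : IsOpen V := by
    refine isOpen_lt (((MvPolynomial.continuous_eval p).sub
      (P.continuous.comp (continuous_apply i))).abs) continuous_const
  have hsubV : (⋂ j, K j) ⊆ V := by
    intro z hz
    have h : (fun j => x j + (z i - x i) * v j) = z := funext fun j => (hline z hz j).symm
    change |MvPolynomial.eval z p - P.eval (z i)| < κ
    rw [hPe, h, sub_self, abs_zero]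
    exact hκ
  obtain ⟨j, hj⟩ := exists_subset_nhds_of_isCompact' (directed_of_isDirected_le hanti)
    (fun m => (hK m).1) (fun m => (hK m).1.isClosed) (fun z hz => hVo.mem_nhds (hsubV hz))
  obtain ⟨hKc, hKconv, hKf, hKg⟩ := hK j
  generalize K j = L at *
  have hLm : MeasurableSet L := hKc.isClosed.measurableSet
  rw [integral_sub hpi.integrableOn (integrable_const _)] at hKf
  rw [integral_sub hFi.integrableOn (integrable_const _), integral_indicator_one hFm] at hKg
  simp only [integral_const, measureReal_restrict_apply_univ, smul_eq_mul,
    measureReal_restrict_apply hFm] at hKf hKg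
  have hLpos : 0 < μ.real L := by
    refine lt_of_le_of_ne measureReal_nonneg fun h => ?_
    have h0 : μ L = 0 := by
      rwa [eq_comm, measureReal_def, ENNReal.toReal_eq_zero_iff, or_iff_left (measure_ne_top _ _)]
        at h
    rw [Measure.restrict_eq_zero.2 h0, ← h] at hKf
    simp at hKf
  have hneedle := setLIntegral_abs_eval_coord_le i hLm hKconv hk hPd (ε := ε + κ) (by positivity) ha
    (by
      have h1 : F ∩ L ⊆ L ∩ {z | |P.eval (z i)| ≤ ε + κ} := by
        rintro z ⟨hzF, hzL⟩
        have h2 : |MvPolynomial.eval z p| ≤ ε := hzF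
        have h3 : |MvPolynomial.eval z p - P.eval (z i)| < κ := hj hzL
        refine ⟨hzL, ?_⟩
        change |P.eval (z i)| ≤ ε + κ
        rw [abs_le] at h2 ⊢
        rw [abs_lt] at h3
        constructor <;> linarith
      have := measureReal_mono (μ := μ) h1
      linarith)
  set A := (ε + κ) * (524288 * k / a) ^ k with hA
  have hA0 : 0 ≤ A := by positivity
  have hbound : ∫ z in L, MvPolynomial.eval z p ∂μ ≤ (A + κ) * μ.real L := by
    have hPm : Measurable fun z : Fin (n + 1) → ℝ => P.eval (z i) :=
      P.continuous.measurable.comp (measurable_pi_apply i)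
    have hPL : IntegrableOn (fun z => P.eval (z i)) L μ := by
      refine ⟨hPm.aestronglyMeasurable, ?_⟩
      rw [HasFiniteIntegral]
      simp_rw [Real.enorm_eq_ofReal_abs]
      exact hneedle.trans_lt (ENNReal.mul_lt_top ENNReal.ofReal_lt_top (measure_lt_top _ _))
    have habs : ∫ z in L, |P.eval (z i)| ∂μ ≤ A * μ.real L := by
      rw [integral_eq_lintegral_of_nonneg_ae (Eventually.of_forall fun _ => abs_nonneg _)
        hPm.norm.aestronglyMeasurable]
      refine (ENNReal.toReal_mono (ENNReal.mul_ne_top ENNReal.ofReal_ne_top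
        (measure_ne_top _ _)) hneedle).trans_eq ?_
      rw [ENNReal.toReal_mul, ENNReal.toReal_ofReal hA0]
      rfl
    calc ∫ z in L, MvPolynomial.eval z p ∂μ ≤ ∫ z in L, (|P.eval (z i)| + κ) ∂μ := by
          refine setIntegral_mono_on hpi.integrableOn
            (hPL.abs.add (integrable_const _)) hLm fun z hz => ?_
          have h3 : |MvPolynomial.eval z p - P.eval (z i)| < κ := hj hz
          linarith [(abs_lt.1 h3).2, le_abs_self (P.eval (z i))]
      _ = ∫ z in L, |P.eval (z i)| ∂μ + κ * μ.real L := by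
          rw [integral_add hPL.abs (integrable_const _)]
          simp [mul_comm]
      _ ≤ _ := by linarith
  have : μ.real L * m < μ.real L * (A + κ) := by linarith
  exact (lt_of_mul_lt_mul_left this hLpos.le).le

theorem measureReal_abs_eval_le {n k : ℕ} (hk : 1 ≤ k) (p : MvPolynomial (Fin (n + 1)) ℝ)
    (hp : p.totalDegree ≤ k) {ε : ℝ} (hε : 0 ≤ ε)
    (hmean : 0 < ∫ z, MvPolynomial.eval z p ∂gaussianPi (n + 1)) :
    (gaussianPi (n + 1)).real {z | |MvPolynomial.eval z p| ≤ ε} ≤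
      524288 * k * (ε / ∫ z, MvPolynomial.eval z p ∂gaussianPi (n + 1)) ^ (k : ℝ)⁻¹ := by
  set M := ∫ z, MvPolynomial.eval z p ∂gaussianPi (n + 1)
  have hk0 : k ≠ 0 := by omega
  refine le_of_forall_lt_imp_le_of_dense fun a hlt => ?_
  rcases le_or_gt a 0 with ha | ha
  · exact ha.trans (by positivity)
  have hM : M ≤ ε * (524288 * k / a) ^ k := by
    refine le_of_forall_lt_imp_le_of_dense fun m hm => ?_
    have hlim : Tendsto (fun κ : ℝ => (ε + κ) * (524288 * k / a) ^ k + κ) (nhdsWithin 0 (Set.Ioi 0))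
        (nhds (ε * (524288 * k / a) ^ k)) := by
      have hc : Continuous fun κ : ℝ => (ε + κ) * (524288 * k / a) ^ k + κ := by fun_prop
      simpa using (hc.tendsto 0).mono_left nhdsWithin_le_nhds
    refine ge_of_tendsto hlim ?_
    filter_upwards [self_mem_nhdsWithin] with κ hκ
    exact mean_le_of_measure_abs_le hk p hp hε ha hκ hm hlt
  have hpow : (a / (524288 * k)) ^ k ≤ ε / M := by
    rw [le_div_iff₀ hmean, div_pow, div_mul_eq_mul_div, div_le_iff₀ (by positivity)]
    rw [div_pow, ← mul_div_assoc, le_div_iff₀ (by positivity)] at hM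
    linarith
  have hroot : a / (524288 * k) ≤ (ε / M) ^ (k : ℝ)⁻¹ := by
    rw [← Real.pow_rpow_inv_natCast (x := a / (524288 * k)) (by positivity) hk0]
    exact Real.rpow_le_rpow (by positivity) hpow (by positivity)
  rwa [div_le_iff₀' (by positivity)] at hroot

theorem measureReal_abs_eval_sub_le {n k : ℕ} (hk : 1 ≤ k) (Q : MvPolynomial (Fin (n + 1)) ℝ)
    (hQ : Q.totalDegree ≤ k) {δ t : ℝ} (hδ : 0 ≤ δ)
    (ht : 0 < |t - ∫ z, MvPolynomial.eval z Q ∂gaussianPi (n + 1)|) :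
    (gaussianPi (n + 1)).real {z | |MvPolynomial.eval z Q - t| ≤ δ} ≤
      524288 * k *
        (δ / |t - ∫ z, MvPolynomial.eval z Q ∂gaussianPi (n + 1)|) ^ (k : ℝ)⁻¹ := by
  have hQi := integrable_eval_gaussianPi Q
  have hdeg : (Q - MvPolynomial.C t).totalDegree ≤ k := (Q.totalDegree_sub_C_le t).trans hQ
  have hint : ∫ z, MvPolynomial.eval z (Q - MvPolynomial.C t) ∂gaussianPi (n + 1) =
      (∫ z, MvPolynomial.eval z Q ∂gaussianPi (n + 1)) - t := by
    simp [integral_sub hQi (integrable_const _)]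
  rcases le_total (∫ z, MvPolynomial.eval z Q ∂gaussianPi (n + 1)) t with h | h
  · have hneg : ∫ z, MvPolynomial.eval z (-(Q - MvPolynomial.C t)) ∂gaussianPi (n + 1) =
        t - ∫ z, MvPolynomial.eval z Q ∂gaussianPi (n + 1) := by
      simp_rw [map_neg]
      rw [integral_neg, hint, neg_sub]
    rw [abs_of_nonneg (sub_nonneg.2 h)] at ht ⊢
    rw [← hneg] at ht ⊢
    simpa only [map_neg, map_sub, abs_neg, MvPolynomial.eval_C] using
      measureReal_abs_eval_le hk _ ((MvPolynomial.totalDegree_neg _).trans_le hdeg) hδ ht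
  · rw [abs_sub_comm, abs_of_nonneg (sub_nonneg.2 h)] at ht ⊢
    rw [← hint] at ht ⊢
    simpa only [map_sub, MvPolynomial.eval_C] using measureReal_abs_eval_le hk _ hdeg hδ ht

end

/-- Carbery–Wright-type anticoncentration for polynomials of degree at
most `k` in `n` i.i.d. standard Gaussians. -/
theorem carbery_wright_consequence :
    ∃ C : ℝ, 0 < C ∧
      ∀ (k n : ℕ), 1 ≤ k → 1 ≤ n →
      ∀ Q : MvPolynomial (Fin n) ℝ, Q.totalDegree ≤ k →
      ∀ (t δ E : ℝ),
        E = (∫ z, MvPolynomial.eval z Q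
          ∂(MeasureTheory.Measure.pi fun _ : Fin n => ProbabilityTheory.gaussianReal 0 1)) →
        0 < δ → δ < |t - E| →
        (MeasureTheory.Measure.pi fun _ : Fin n => ProbabilityTheory.gaussianReal 0 1)
            {z | |MvPolynomial.eval z Q - t| ≤ δ} ≤
          ENNReal.ofReal
            (C * k * (δ / (|t - E| - δ)) ^ ((2 : ℝ) / (2 * k + 1))) := by
  refine ⟨524288, by norm_num, fun k n hk hn Q hQ t δ E hE hδ hδE => ?_⟩
  obtain ⟨n, rfl⟩ : ∃ m, n = m + 1 := ⟨n - 1, by omega⟩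
  change E = ∫ z, MvPolynomial.eval z Q ∂gaussianPi (n + 1) at hE
  have hpos : 0 < |t - E| := hδ.trans hδE
  have hk1 : (1 : ℝ) ≤ k := by exact_mod_cast hk
  have hgap : 0 < |t - E| - δ := sub_pos.2 hδE
  have hr : 0 < δ / (|t - E| - δ) := div_pos hδ hgap
  rw [← ofReal_measureReal (measure_ne_top _ _)]
  refine ENNReal.ofReal_le_ofReal ?_
  rcases le_or_gt 1 (δ / (|t - E| - δ)) with h1 | h1
  · have h2 := Real.one_le_rpow h1 (show 0 ≤ (2 : ℝ) / (2 * k + 1) by positivity)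
    refine measureReal_le_one.trans ?_
    nlinarith
  · have h2 := measureReal_abs_eval_sub_le hk Q hQ (t := t) hδ.le (hE ▸ hpos)
    rw [← hE] at h2
    refine h2.trans (mul_le_mul_of_nonneg_left ?_ (by positivity))
    calc (δ / |t - E|) ^ (k : ℝ)⁻¹ ≤ (δ / (|t - E| - δ)) ^ (k : ℝ)⁻¹ := by
          gcongr
          linarith
      _ ≤ _ := by
          refine Real.rpow_le_rpow_of_exponent_ge hr h1.le ?_
          rw [inv_eq_one_div, div_le_div_iff₀ (by positivity) (by positivity)]
          linarith
end
end
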